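/- arXiv:2203.10559 — 17 statements merged into one kernel-verified Lean document; each statement's English description precedes it below -/
import Mathlib

section
/- Let T₀ > 0, let γ : ℝ → ℝ² be C¹ with γ(s + 2T₀) = γ(s) for all s, and let t : ℝ → ℝ be differentiable with s < t(s) < s + 2T₀ for all s. Suppose every chord from γ(s) to γ(t(s)) bisects the enclosed area, i.e. for all s: ∫ₛ^{t(s)} [γ(u) − γ(s), γ'(u)] du = (1/2) · ∫₀^{2T₀} [γ(u), γ'(u)] du. Then for every s: [γ'(s), γ(t(s)) − γ(s)] = t'(s) · [γ'(t(s)), γ(s) − γ(t(s))]. -/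
open intervalIntegral

/-- The 2×2 determinant `[P,Q] = p₁q₂ − p₂q₁` of two vectors in the plane. -/
noncomputable def det2 (P Q : ℝ × ℝ) : ℝ := P.1 * Q.2 - P.2 * Q.1

/-- The derivative of a moving determinant obeys the Leibniz rule. -/
theorem HasDerivAt.det2_curves {f g : ℝ → ℝ × ℝ} {f' g' : ℝ × ℝ} {x : ℝ}
    (hf : HasDerivAt f f' x) (hg : HasDerivAt g g' x) :
    HasDerivAt (fun y => det2 (f y) (g y)) (det2 f' (g x) + det2 (f x) g') x := by
  have hfst : ∀ {h : ℝ → ℝ × ℝ} {h' : ℝ × ℝ}, HasDerivAt h h' x →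
      HasDerivAt (fun y => (h y).1) h'.1 x := fun hh => by
    simpa using (HasFDerivAt.fst hh.hasFDerivAt).hasDerivAt
  have hsnd : ∀ {h : ℝ → ℝ × ℝ} {h' : ℝ × ℝ}, HasDerivAt h h' x →
      HasDerivAt (fun y => (h y).2) h'.2 x := fun hh => by
    simpa using (HasFDerivAt.snd hh.hasFDerivAt).hasDerivAt
  refine (((hfst hf).mul (hsnd hg)).sub ((hsnd hf).mul (hfst hg))).congr_deriv ?_
  simp only [det2]
  ring

theorem Continuous.det2_curves {f g : ℝ → ℝ × ℝ} (hf : Continuous f) (hg : Continuous g) :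
    Continuous (fun y => det2 (f y) (g y)) := by
  unfold det2
  fun_prop

/-- The area swept from a point `P` is the area swept from the origin minus a boundary term. -/
theorem integral_det2_sub_const {γ : ℝ → ℝ × ℝ} (hγ : ContDiff ℝ 1 γ) (P : ℝ × ℝ) (a b : ℝ) :
    (∫ u in a..b, det2 (γ u - P) (deriv γ u)) =
      (∫ u in a..b, det2 (γ u) (deriv γ u)) - det2 P (γ b - γ a) := by
  have hd : Continuous (deriv γ) := hγ.continuous_deriv le_rfl
  have hP : (∫ u in a..b, det2 P (deriv γ u)) = det2 P (γ b) - det2 P (γ a) := by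
    refine integral_eq_sub_of_hasDerivAt (f := fun u => det2 P (γ u)) (fun x _ => ?_)
      ((continuous_const.det2_curves hd).intervalIntegrable a b)
    have h := (hasDerivAt_const x P).det2_curves (hγ.differentiable one_ne_zero x).hasDerivAt
    simpa [det2] using h
  have hsplit : ∀ u, det2 (γ u - P) (deriv γ u) =
      det2 (γ u) (deriv γ u) - det2 P (deriv γ u) := fun u => by
    simp only [det2, Prod.fst_sub, Prod.snd_sub]
    ring
  simp only [hsplit]
  rw [integral_sub ((hγ.continuous.det2_curves hd).intervalIntegrable a b)
    ((continuous_const.det2_curves hd).intervalIntegrable a b), hP]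
  simp only [det2, Prod.fst_sub, Prod.snd_sub]
  ring

theorem bisecting_chord_derivative_relation
    (T₀ : ℝ) (hT₀ : 0 < T₀)
    (γ : ℝ → ℝ × ℝ) (hγ : ContDiff ℝ 1 γ)
    (hper : ∀ s, γ (s + 2 * T₀) = γ s)
    (t : ℝ → ℝ) (ht : Differentiable ℝ t)
    (hrange : ∀ s, s < t s ∧ t s < s + 2 * T₀)
    (harea : ∀ s, (∫ u in s..(t s), det2 (γ u - γ s) (deriv γ u)) =
      (1 / 2) * ∫ u in (0:ℝ)..(2 * T₀), det2 (γ u) (deriv γ u)) :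
    ∀ s, det2 (deriv γ s) (γ (t s) - γ s) =
      deriv t s * det2 (deriv γ (t s)) (γ s - γ (t s)) := by
  intro s
  have hint : Continuous fun u => det2 (γ u) (deriv γ u) :=
    hγ.continuous.det2_curves (hγ.continuous_deriv le_rfl)
  have hF : ∀ x, HasDerivAt (fun y => ∫ u in (0:ℝ)..y, det2 (γ u) (deriv γ u))
      (det2 (γ x) (deriv γ x)) x := fun x => hint.integral_hasStrictDerivAt 0 x |>.hasDerivAt
  have hγd : ∀ x, HasDerivAt γ (deriv γ x) x :=
    fun x => (hγ.differentiable one_ne_zero x).hasDerivAt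
  have hts := (ht s).hasDerivAt
  have hγt : HasDerivAt (fun y => γ (t y)) (deriv t s • deriv γ (t s)) s :=
    (hγd (t s)).scomp s hts
  have hA := (((hF (t s)).comp s hts).sub (hF s)).sub ((hγd s).det2_curves (hγt.sub (hγd s)))
  have hconst := hA.unique ((hasDerivAt_const s
    ((1 / 2) * ∫ u in (0:ℝ)..(2 * T₀), det2 (γ u) (deriv γ u))).congr_of_eventuallyEq
      (Filter.Eventually.of_forall fun x => by
        rw [← harea x, integral_det2_sub_const hγ,
          ← integral_interval_sub_left (hint.intervalIntegrable 0 (t x))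
            (hint.intervalIntegrable 0 x)]
        rfl))
  simp only [det2, Prod.fst_sub, Prod.snd_sub, Prod.smul_fst, Prod.smul_snd, smul_eq_mul,
    Pi.sub_apply] at hconst ⊢
  linear_combination -hconst
end

section
/- Let T₀ > 0, let γ : ℝ → ℝ² be C¹ with γ(s + 2T₀) = γ(s) for all s, and let t : ℝ → ℝ be differentiable with s < t(s) < s + 2T₀ and t(t(s)) = s + 2T₀ for all s. Suppose that for all s: ∫ₛ^{t(s)} [γ(u) − γ(s), γ'(u)] du = (1/2) · ∫₀^{2T₀} [γ(u), γ'(u)] du (each chord γ(s)γ(t(s)) bisects the enclosed area), and that there is a constant a ≠ 0 with [γ'(s), γ(t(s)) − γ(s)] = a for all s (half-area parameterization). Then t(s) = s + T₀ for all s. -/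
open intervalIntegral

theorem HasDerivAt.det2 {P Q : ℝ → ℝ × ℝ} {P' Q' : ℝ × ℝ} {s : ℝ}
    (hP : HasDerivAt P P' s) (hQ : HasDerivAt Q Q' s) :
    HasDerivAt (fun u => det2 (P u) (Q u)) (_root_.det2 P' (Q s) + _root_.det2 (P s) Q') s := by
  have hP1 : HasDerivAt (fun u => (P u).1) P'.1 s := hP.fst
  have hP2 : HasDerivAt (fun u => (P u).2) P'.2 s := hP.snd
  have hQ1 : HasDerivAt (fun u => (Q u).1) Q'.1 s := hQ.fst
  have hQ2 : HasDerivAt (fun u => (Q u).2) Q'.2 s := hQ.snd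
  refine ((hP1.mul hQ2).sub (hP2.mul hQ1)).congr_deriv ?_
  simp only [_root_.det2]
  ring

theorem Continuous.det2 {P Q : ℝ → ℝ × ℝ} (hP : Continuous P) (hQ : Continuous Q) :
    Continuous fun u => det2 (P u) (Q u) := by
  unfold _root_.det2
  fun_prop

theorem integral_det2_sub_deriv {γ : ℝ → ℝ × ℝ} (hγ : ContDiff ℝ 1 γ) (P : ℝ × ℝ) (x y : ℝ) :
    ∫ u in x..y, det2 (γ u - P) (deriv γ u) =
      (∫ u in x..y, det2 (γ u) (deriv γ u)) - det2 P (γ y - γ x) := by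
  have hγ' : Continuous (deriv γ) := hγ.continuous_deriv le_rfl
  have hchord : ∫ u in x..y, det2 P (deriv γ u) = det2 P (γ y - γ x) := by
    rw [integral_eq_sub_of_hasDerivAt (f := fun u => det2 P (γ u))]
    · simp only [det2, Prod.fst_sub, Prod.snd_sub]
      ring
    · intro u _
      refine ((hasDerivAt_const u P).det2
        (hγ.differentiable one_ne_zero u).hasDerivAt).congr_deriv ?_
      simp [det2]
    · exact (continuous_const.det2 hγ').intervalIntegrable _ _
  rw [← hchord, ← integral_sub ((hγ.continuous.det2 hγ').intervalIntegrable _ _)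
    ((continuous_const.det2 hγ').intervalIntegrable _ _)]
  congr 1 with u
  simp only [det2, Prod.fst_sub, Prod.snd_sub]
  ring

/-- Derivative of the area cut off by the moving chord from `γ s` to `γ (t s)`. -/
theorem hasDerivAt_integral_det2_chord {γ : ℝ → ℝ × ℝ} (hγ : ContDiff ℝ 1 γ) {t : ℝ → ℝ}
    {s t' : ℝ} (ht : HasDerivAt t t' s) :
    HasDerivAt (fun x => ∫ u in x..(t x), det2 (γ u - γ x) (deriv γ u))
      (t' * det2 (deriv γ (t s)) (γ s - γ (t s)) - det2 (deriv γ s) (γ (t s) - γ s)) s := by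
  have hγd : ∀ u, HasDerivAt γ (deriv γ u) u := fun u =>
    (hγ.differentiable one_ne_zero u).hasDerivAt
  have hcont : Continuous fun u => det2 (γ u) (deriv γ u) :=
    hγ.continuous.det2 (hγ.continuous_deriv le_rfl)
  have hprim : ∀ y, HasDerivAt (fun y => ∫ u in (0 : ℝ)..y, det2 (γ u) (deriv γ u))
      (det2 (γ y) (deriv γ y)) y := fun y =>
    integral_hasDerivAt_right (hcont.intervalIntegrable _ _)
      hcont.aestronglyMeasurable.stronglyMeasurableAtFilter hcont.continuousAt
  have hsplit : (fun x => ∫ u in x..(t x), det2 (γ u - γ x) (deriv γ u)) = fun x =>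
      ((∫ u in (0 : ℝ)..(t x), det2 (γ u) (deriv γ u)) -
        ∫ u in (0 : ℝ)..x, det2 (γ u) (deriv γ u)) - det2 (γ x) (γ (t x) - γ x) := by
    funext x
    rw [integral_det2_sub_deriv hγ, integral_interval_sub_left
      (hcont.intervalIntegrable _ _) (hcont.intervalIntegrable _ _)]
  rw [hsplit]
  have hγt : HasDerivAt (fun x => γ (t x)) (t' • deriv γ (t s)) s :=
    (hγd (t s)).scomp s ht
  refine ((((hprim (t s)).comp s ht).sub (hprim s)).sub
    ((hγd s).det2 (hγt.sub (hγd s)))).congr_deriv ?_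
  simp only [det2, Pi.sub_apply, Prod.fst_sub, Prod.snd_sub, Prod.smul_fst, Prod.smul_snd,
    smul_eq_mul]
  ring

theorem half_area_parameterization_chord
    (T₀ : ℝ) (hT₀ : 0 < T₀)
    (γ : ℝ → ℝ × ℝ) (hγ : ContDiff ℝ 1 γ)
    (hper : ∀ s, γ (s + 2 * T₀) = γ s)
    (t : ℝ → ℝ) (ht : Differentiable ℝ t)
    (hrange : ∀ s, s < t s ∧ t s < s + 2 * T₀)
    (hinv : ∀ s, t (t s) = s + 2 * T₀)
    (harea : ∀ s, (∫ u in s..(t s), det2 (γ u - γ s) (deriv γ u)) =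
      (1 / 2) * ∫ u in (0:ℝ)..(2 * T₀), det2 (γ u) (deriv γ u))
    (a : ℝ) (ha : a ≠ 0)
    (hhalf : ∀ s, det2 (deriv γ s) (γ (t s) - γ s) = a) :
    ∀ s, t s = s + T₀ := by
  have hderiv : ∀ s, deriv t s = 1 := fun s => by
    have hmoving := hasDerivAt_integral_det2_chord hγ (ht s).hasDerivAt
    rw [funext harea] at hmoving
    have hzero := hmoving.unique (hasDerivAt_const s _)
    have hback := hhalf (t s)
    rw [hinv, hper] at hback
    rw [hback, hhalf] at hzero
    exact mul_right_cancel₀ ha (by linarith)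
  have hconst : ∀ x y, t x - x = t y - y :=
    is_const_of_deriv_eq_zero (f := fun x => t x - x) (ht.sub differentiable_id) fun x => by
      refine ((ht x).hasDerivAt.sub (hasDerivAt_id x)).deriv.trans ?_
      rw [hderiv, sub_self]
  intro s
  linarith [hconst (t s) s, hinv s]
end

section
/- Let T₀ > 0 and let γ : ℝ → ℝ² be C¹ with γ(s + 2T₀) = γ(s) for all s. Set v(s) := γ(s + T₀) − γ(s) and assume there is a constant a ≠ 0 with [γ'(s), v(s)] = a for all s (half-area parameterization). Define 𝓔(s) := (γ(s) + γ(s + T₀))/2. Then for every s₀: 𝓔'(s₀) = 0 if and only if [γ'(s₀), γ'(s₀ + T₀)] = 0. -/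
/-- A vector parallel to both members of a linearly independent pair vanishes. -/
theorem eq_zero_of_det2_eq_zero {P V W : ℝ × ℝ} (hPV : det2 P V ≠ 0)
    (hPW : det2 P W = 0) (hWV : det2 W V = 0) : W = 0 := by
  unfold det2 at hPV hPW hWV
  refine Prod.ext ?_ ?_
  · refine (mul_eq_zero.mp ?_).resolve_left hPV
    linear_combination P.1 * hWV + V.1 * hPW
  · refine (mul_eq_zero.mp ?_).resolve_left hPV
    linear_combination P.2 * hWV + V.2 * hPW

theorem envelope_stationary_iff_pt_vertex
    (T₀ : ℝ) (hT₀ : 0 < T₀)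
    (γ : ℝ → ℝ × ℝ) (hγ : ContDiff ℝ 1 γ)
    (hper : ∀ s, γ (s + 2 * T₀) = γ s)
    (v : ℝ → ℝ × ℝ) (hv : ∀ s, v s = γ (s + T₀) - γ s)
    (a : ℝ) (ha : a ≠ 0)
    (hhalf : ∀ s, det2 (deriv γ s) (v s) = a)
    (E : ℝ → ℝ × ℝ) (hE : ∀ s, E s = ((1:ℝ) / 2) • (γ s + γ (s + T₀))) :
    ∀ s₀, deriv E s₀ = 0 ↔ det2 (deriv γ s₀) (deriv γ (s₀ + T₀)) = 0 := by
  intro s₀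
  have hd : Differentiable ℝ γ := hγ.differentiable one_ne_zero
  have hderiv : deriv E s₀ = ((1 : ℝ) / 2) • (deriv γ s₀ + deriv γ (s₀ + T₀)) := by
    rw [funext hE]
    exact (((hd s₀).hasDerivAt.add
      ((hd (s₀ + T₀)).hasDerivAt.comp_add_const s₀ T₀)).const_smul ((1 : ℝ) / 2)).deriv
  have hzero : deriv E s₀ = 0 ↔ deriv γ s₀ + deriv γ (s₀ + T₀) = 0 := by
    rw [hderiv, smul_eq_zero_iff_right (by norm_num)]
  have hv_neg : v (s₀ + T₀) = -v s₀ := by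
    rw [hv, hv, add_assoc, ← two_mul, hper, neg_sub]
  have h₀ := hhalf s₀
  have h₁ := hhalf (s₀ + T₀)
  rw [hv_neg] at h₁
  rw [hzero]
  constructor
  · intro h
    rw [eq_neg_of_add_eq_zero_right h]
    simp only [det2, Prod.fst_neg, Prod.snd_neg]
    ring
  · intro h
    refine eq_zero_of_det2_eq_zero (h₀.trans_ne ha) ?_ ?_
    · simp only [det2, Prod.fst_add, Prod.snd_add] at h ⊢
      linear_combination h
    · simp only [det2, Prod.fst_add, Prod.snd_add, Prod.fst_neg, Prod.snd_neg] at h₀ h₁ ⊢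
      linear_combination h₀ - h₁
end

section
/- Let T₀ > 0 and let γ : ℝ → ℝ² be C² with γ(s + 2T₀) = γ(s) for all s. Set v(s) := γ(s + T₀) − γ(s) and assume there is a constant a ≠ 0 with [γ'(s), v(s)] = a for all s (half-area parameterization). Define 𝓔(s) := (γ(s) + γ(s + T₀))/2 and α(s) := [γ'(s), γ'(s + T₀)]/a. If α(s₀) = 0, then 𝓔''(s₀) = (α'(s₀)/2) · v(s₀); in particular, if moreover α'(s₀) ≠ 0, then 𝓔''(s₀) ≠ 0 (𝓔 has a cusp at s₀). -/
/-- The three-term Plücker relation for vectors in the plane. -/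
theorem det2_smul_eq (A B w : ℝ × ℝ) :
    det2 A B • w = det2 A w • B - det2 B w • A := by
  ext <;> simp [det2] <;> ring

theorem DifferentiableAt.det2 {f g : ℝ → ℝ × ℝ} {s : ℝ}
    (hf : DifferentiableAt ℝ f s) (hg : DifferentiableAt ℝ g s) :
    DifferentiableAt ℝ (fun t => _root_.det2 (f t) (g t)) s := by
  unfold _root_.det2
  exact (hf.fst.mul hg.snd).sub (hf.snd.mul hg.fst)

theorem envelope_cusp_at_ordinary_pt_vertex
    (T₀ : ℝ) (hT₀ : 0 < T₀)
    (γ : ℝ → ℝ × ℝ) (hγ : ContDiff ℝ 2 γ)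
    (hper : ∀ s, γ (s + 2 * T₀) = γ s)
    (v : ℝ → ℝ × ℝ) (hv : ∀ s, v s = γ (s + T₀) - γ s)
    (a : ℝ) (ha : a ≠ 0)
    (hhalf : ∀ s, det2 (deriv γ s) (v s) = a)
    (E : ℝ → ℝ × ℝ) (hE : ∀ s, E s = ((1:ℝ) / 2) • (γ s + γ (s + T₀)))
    (α : ℝ → ℝ) (hα : ∀ s, α s = det2 (deriv γ s) (deriv γ (s + T₀)) / a)
    (s₀ : ℝ) (hs₀ : α s₀ = 0) :
    deriv (deriv E) s₀ = (deriv α s₀ / 2) • v s₀ ∧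
      (deriv α s₀ ≠ 0 → deriv (deriv E) s₀ ≠ 0) := by
  have hd : Differentiable ℝ γ := hγ.differentiable (by norm_num)
  have hd' : Differentiable ℝ (deriv γ) :=
    ((contDiff_succ_iff_deriv (n := 1)).1 hγ).2.2.differentiable (by norm_num)
  have hshift : ∀ s, HasDerivAt (fun t => γ (t + T₀)) (deriv γ (s + T₀)) s := fun s =>
    (hd (s + T₀)).hasDerivAt.comp_add_const s T₀
  have hvT : ∀ s, v (s + T₀) = -v s := by
    intro s
    rw [hv, hv, show s + T₀ + T₀ = s + 2 * T₀ by ring, hper, neg_sub]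
  have hhalf' : ∀ s, det2 (deriv γ (s + T₀)) (v s) = -a := by
    intro s
    have h := hhalf (s + T₀)
    rw [hvT] at h
    simp only [det2, Prod.fst_neg, Prod.snd_neg] at h ⊢
    linarith
  have hE' : deriv E = fun s => (α s / 2) • v s := by
    funext s
    have h : HasDerivAt E (((1:ℝ) / 2) • (deriv γ s + deriv γ (s + T₀))) s := by
      rw [funext hE]
      exact ((hd s).hasDerivAt.add (hshift s)).const_smul ((1:ℝ) / 2)
    have hp := det2_smul_eq (deriv γ s) (deriv γ (s + T₀)) (v s)
    rw [hhalf, hhalf'] at hp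
    have hsum : deriv γ s + deriv γ (s + T₀) = α s • v s := by
      rw [hα, div_eq_inv_mul, mul_smul, hp, neg_smul, sub_neg_eq_add, ← smul_add,
        inv_smul_smul₀ ha, add_comm]
    rw [h.deriv, hsum, smul_smul]
    congr 1
    ring
  have hdα : DifferentiableAt ℝ α s₀ := by
    rw [funext hα]
    have h := ((hd' (s₀ + T₀)).hasDerivAt.comp_add_const s₀ T₀).differentiableAt
    exact ((hd' s₀).det2 h).div_const a
  have hdv : DifferentiableAt ℝ v s₀ := by
    rw [funext hv]
    exact (hshift s₀).differentiableAt.sub (hd s₀)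
  have hE'' : deriv (deriv E) s₀ = (deriv α s₀ / 2) • v s₀ := by
    have h := (hdα.hasDerivAt.div_const 2).smul hdv.hasDerivAt
    rw [hs₀, zero_div, zero_smul, zero_add] at h
    rw [hE']
    exact h.deriv
  refine ⟨hE'', fun hα' => ?_⟩
  have hv₀ : v s₀ ≠ 0 := by
    intro h
    apply ha
    rw [← hhalf s₀, h]
    simp [det2]
  rw [hE'']
  exact smul_ne_zero (div_ne_zero hα' two_ne_zero) hv₀
end

section
/- Let T₀ > 0 and let γ : ℝ → ℝ² be C¹ with γ(s + 2T₀) = γ(s) for all s. Set v(s) := γ(s + T₀) − γ(s) and assume there is a constant a ≠ 0 with [γ'(s), v(s)] = a for all s (half-area parameterization). Then the vector-valued integral ∫₀^{2T₀} [γ'(s), γ'(s + T₀)] · γ(s) ds equals 0 ∈ ℝ². -/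
open intervalIntegral

/-- The three-term Plücker relation in the plane, solved for the third vector. -/
theorem det2_smul_eq_sub (P Q V : ℝ × ℝ) :
    det2 P Q • V = det2 P V • Q - det2 Q V • P := by
  ext <;> simp only [det2, Prod.smul_fst, Prod.smul_snd, Prod.fst_sub, Prod.snd_sub,
    smul_eq_mul] <;> ring

theorem integral_alpha_gamma_eq_zero
    (T₀ : ℝ) (hT₀ : 0 < T₀)
    (γ : ℝ → ℝ × ℝ) (hγ : ContDiff ℝ 1 γ)
    (hper : ∀ s, γ (s + 2 * T₀) = γ s)
    (v : ℝ → ℝ × ℝ) (hv : ∀ s, v s = γ (s + T₀) - γ s)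
    (a : ℝ) (ha : a ≠ 0)
    (hhalf : ∀ s, det2 (deriv γ s) (v s) = a) :
    (∫ s in (0:ℝ)..(2 * T₀), det2 (deriv γ s) (deriv γ (s + T₀)) • γ s) = (0 : ℝ × ℝ) := by
  have hper_shift : ∀ s, γ (s + T₀ + T₀) = γ s := fun s => by
    rw [← hper s]; congr 1; ring
  have hderiv_shift : ∀ s, deriv γ (s + T₀ + T₀) = deriv γ s := fun s => by
    rw [add_assoc, ← deriv_comp_add_const]
    congr 1
    funext x
    rw [← add_assoc, hper_shift]
  have hγc : Continuous γ := hγ.continuous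
  have hdc : Continuous (deriv γ) := hγ.continuous_deriv le_rfl
  have hd : ∀ s, HasDerivAt γ (deriv γ s) s := fun s =>
    (hγ.differentiable one_ne_zero s).hasDerivAt
  set f : ℝ → ℝ × ℝ := fun s => det2 (deriv γ s) (deriv γ (s + T₀)) • γ s with hf
  have hfc : Continuous f := by
    simp only [hf, det2]
    fun_prop
  have hsum : ∀ s, f s + f (s + T₀) = (-a) • (deriv γ s + deriv γ (s + T₀)) := fun s => by
    have hanti : det2 (deriv γ (s + T₀)) (deriv γ s) = -det2 (deriv γ s) (deriv γ (s + T₀)) := by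
      simp only [det2]; ring
    have hneg : det2 (deriv γ (s + T₀)) (v s) = -a := by
      rw [← hhalf (s + T₀), hv, hv, hper_shift]
      simp only [det2, Prod.fst_sub, Prod.snd_sub]; ring
    have hplucker := det2_smul_eq_sub (deriv γ s) (deriv γ (s + T₀)) (v s)
    rw [hhalf, hneg, hv] at hplucker
    simp only [hf]
    rw [hderiv_shift, hanti]
    linear_combination (norm := module) -hplucker
  have hshift : ∫ s in T₀..(2 * T₀), f s = ∫ s in (0:ℝ)..T₀, f (s + T₀) := by
    rw [integral_comp_add_right, zero_add, two_mul]
  rw [← integral_add_adjacent_intervals (hfc.intervalIntegrable 0 T₀)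
    (hfc.intervalIntegrable T₀ (2 * T₀)), hshift, ← integral_add (hfc.intervalIntegrable _ _)
    (Continuous.intervalIntegrable (by fun_prop) _ _)]
  simp only [hsum]
  rw [integral_smul, integral_eq_sub_of_hasDerivAt (f := fun s => γ s + γ (s + T₀))
    (fun s _ => (hd s).add ((hd (s + T₀)).comp_add_const s T₀))
    (Continuous.intervalIntegrable (by fun_prop) _ _)]
  have hend : γ (T₀ + T₀) = γ 0 := by simpa using hper_shift 0
  simp only [hend, zero_add, add_comm (γ T₀), sub_self, smul_zero]
end

section
/- Let T₀ > 0 and let γ : ℝ → ℝ² be C¹ with γ(s + 2T₀) = γ(s) for all s, parameterizing a strictly convex closed curve positively: [γ'(s), γ(u) − γ(s)] > 0 whenever u − s is not an integer multiple of 2T₀. Assume there is a constant a > 0 with [γ'(s), γ(s+T₀) − γ(s)] = a for all s (half-area parameterization). Let α(s) := [γ'(s), γ'(s + T₀)] and assume α has only finitely many zeros in [0, 2T₀). Then the number of points s₀ ∈ [0, T₀) at which α changes sign (i.e. α(s₀) = 0 and there is ε > 0 with α(s₀ − h)·α(s₀ + h) < 0 for all 0 < h < ε) is odd and at least 3. 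-/
open Filter Topology Set

/-- `g` keeps its sign when crossing `x`. -/
def KeepsSignAt (g : ℝ → ℝ) (x : ℝ) : Prop := ∀ᶠ h in 𝓝[>] (0:ℝ), 0 < g (x - h) * g (x + h)

/-- `g` switches its sign when crossing `x`. -/
def SwitchesSignAt (g : ℝ → ℝ) (x : ℝ) : Prop := ∀ᶠ h in 𝓝[>] (0:ℝ), g (x - h) * g (x + h) < 0

theorem switchesSignAt_iff {g : ℝ → ℝ} {x : ℝ} :
    SwitchesSignAt g x ↔ ∃ ε > 0, ∀ h : ℝ, 0 < h → h < ε → g (x - h) * g (x + h) < 0 := by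
  unfold SwitchesSignAt
  rw [Filter.Eventually, mem_nhdsGT_iff_exists_Ioo_subset]
  exact ⟨fun ⟨e, he, H⟩ => ⟨e, he, fun h h0 h1 => H ⟨h0, h1⟩⟩,
    fun ⟨e, he, H⟩ => ⟨e, he, fun h hh => H h hh.1 hh.2⟩⟩

theorem keepsSignAt_iff {g : ℝ → ℝ} {x : ℝ} :
    KeepsSignAt g x ↔ ∃ ε > 0, ∀ h : ℝ, 0 < h → h < ε → 0 < g (x - h) * g (x + h) := by
  unfold KeepsSignAt
  rw [Filter.Eventually, mem_nhdsGT_iff_exists_Ioo_subset]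
  exact ⟨fun ⟨e, he, H⟩ => ⟨e, he, fun h h0 h1 => H ⟨h0, h1⟩⟩,
    fun ⟨e, he, H⟩ => ⟨e, he, fun h hh => H h hh.1 hh.2⟩⟩

theorem KeepsSignAt.mul {f g : ℝ → ℝ} {x : ℝ} (hf : KeepsSignAt f x) (hg : KeepsSignAt g x) :
    KeepsSignAt (fun y => f y * g y) x := by
  filter_upwards [hf, hg] with h h1 h2
  linarith [mul_pos h1 h2]

theorem SwitchesSignAt.mul {f g : ℝ → ℝ} {x : ℝ} (hf : SwitchesSignAt f x)
    (hg : SwitchesSignAt g x) : KeepsSignAt (fun y => f y * g y) x := by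
  filter_upwards [hf, hg] with h h1 h2
  linarith [mul_pos_of_neg_of_neg h1 h2]

theorem SwitchesSignAt.mul_keepsSignAt {f g : ℝ → ℝ} {x : ℝ} (hf : SwitchesSignAt f x)
    (hg : KeepsSignAt g x) : SwitchesSignAt (fun y => f y * g y) x := by
  filter_upwards [hf, hg] with h h1 h2
  linarith [mul_neg_of_neg_of_pos h1 h2]

theorem keepsSignAt_prod {ι : Type*} (s : Finset ι) {f : ι → ℝ → ℝ} {x : ℝ}
    (hf : ∀ i ∈ s, KeepsSignAt (f i) x) : KeepsSignAt (fun y => ∏ i ∈ s, f i y) x := by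
  have : ∀ᶠ h in 𝓝[>] (0:ℝ), ∀ i ∈ s, 0 < f i (x - h) * f i (x + h) :=
    (Filter.eventually_all_finset s).2 hf
  filter_upwards [this] with h hh
  rw [← Finset.prod_mul_distrib]
  exact Finset.prod_pos hh

theorem keepsSignAt_of_ne_zero {g : ℝ → ℝ} (hg : Continuous g) {x : ℝ} (hx : g x ≠ 0) :
    KeepsSignAt g x := by
  have hc : Continuous fun h => g (x - h) * g (x + h) := by fun_prop
  have h0 : 0 < (fun h => g (x - h) * g (x + h)) 0 := by
    simpa using mul_self_pos.2 hx
  exact (hc.continuousAt.eventually (lt_mem_nhds h0)).filter_mono nhdsWithin_le_nhds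

theorem keepsSignAt_or_switchesSignAt {g : ℝ → ℝ} (hg : Continuous g) {x : ℝ}
    (hx : ∀ᶠ h in 𝓝[>] (0:ℝ), g (x - h) * g (x + h) ≠ 0) :
    KeepsSignAt g x ∨ SwitchesSignAt g x := by
  rw [Filter.Eventually, mem_nhdsGT_iff_exists_Ioo_subset] at hx
  obtain ⟨e, he, H⟩ := hx
  have he : 0 < e := he
  have hc : Continuous fun h => g (x - h) * g (x + h) := by fun_prop
  by_contra! hcon
  rw [keepsSignAt_iff, switchesSignAt_iff] at hcon
  obtain ⟨h1, h2⟩ := hcon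
  push Not at h1 h2
  obtain ⟨u, hu0, hu1, hu⟩ := h1 e he
  obtain ⟨v, hv0, hv1, hv⟩ := h2 e he
  obtain ⟨w, hw, hw0⟩ := isPreconnected_Ioo.intermediate_value
    (show u ∈ Ioo 0 e from ⟨hu0, hu1⟩) (show v ∈ Ioo 0 e from ⟨hv0, hv1⟩)
    hc.continuousOn ⟨hu, hv⟩
  exact H hw hw0

theorem not_neg_of_pos_of_forall_keepsSignAt {g : ℝ → ℝ} (hg : Continuous g)
    (h : ∀ x, KeepsSignAt g x) {x y : ℝ} (hxy : x < y) (hx : 0 < g x) : ¬ g y < 0 := by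
  intro hy
  set A := {t ∈ Icc x y | 0 < g t} with hA
  have hne : A.Nonempty := ⟨x, ⟨le_rfl, hxy.le⟩, hx⟩
  have hbdd : BddAbove A := ⟨y, fun t ht => ht.1.2⟩
  have hlub := isLUB_csSup hne hbdd
  set z := sSup A
  have hzy : z ≤ y := hlub.2 fun t ht => ht.1.2
  have hxz : x ≤ z := hlub.1 ⟨⟨le_rfl, hxy.le⟩, hx⟩
  have hz0 : 0 ≤ g z := by
    have hcl : IsClosed {t | 0 ≤ g t} := isClosed_le continuous_const hg
    exact hcl.closure_subset_iff.2 (fun t ht => ht.2.le) (csSup_mem_closure hne hbdd)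
  have hzy : z < y := lt_of_le_of_ne hzy fun h' => by rw [h'] at hz0; linarith
  have hright : ∀ k, 0 < k → k < y - z → g (z + k) ≤ 0 := by
    intro k hk hk'
    by_contra! hp
    have := hlub.1 (show z + k ∈ A from ⟨⟨by linarith, by linarith⟩, hp⟩)
    linarith
  obtain ⟨e, he, H⟩ := keepsSignAt_iff.1 (h z)
  obtain ⟨t, htA, ht⟩ := exists_lt_of_lt_csSup hne
    (show z - min e (y - z) < z by linarith [lt_min he (sub_pos.2 hzy)])
  have htz : t ≤ z := hlub.1 htA
  rcases htz.lt_or_eq with htz | htz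
  · have h1 := H (z - t) (by linarith) (by linarith [min_le_left e (y - z)])
    have h2 := hright (z - t) (by linarith) (by linarith [min_le_right e (y - z)])
    rw [sub_sub_cancel] at h1
    nlinarith [htA.2]
  · rw [htz] at htA
    have hc : Continuous fun k => g (z + k) := by fun_prop
    have h1 : ∀ᶠ k in 𝓝[>] (0:ℝ), 0 < g (z + k) :=
      (hc.continuousAt.eventually (lt_mem_nhds (by simpa using htA.2))).filter_mono
        nhdsWithin_le_nhds
    obtain ⟨k, hk, hk0, hk1⟩ := (h1.and (Ioo_mem_nhdsGT (sub_pos.2 hzy))).exists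
    linarith [hright k hk0 hk1]

theorem mul_nonneg_of_forall_keepsSignAt {g : ℝ → ℝ} (hg : Continuous g)
    (h : ∀ x, KeepsSignAt g x) (x y : ℝ) : 0 ≤ g x * g y := by
  have key : ∀ x y, 0 < g x → ¬ g y < 0 := by
    intro x y hx hy
    rcases lt_trichotomy x y with hxy | rfl | hxy
    · exact not_neg_of_pos_of_forall_keepsSignAt hg h hxy hx hy
    · linarith
    · refine not_neg_of_pos_of_forall_keepsSignAt (g := fun t => - g t) hg.neg (fun z => ?_) hxy
        (by simpa using hy) (by simpa using hx)
      simpa [KeepsSignAt] using h z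
  by_contra! hlt
  rcases mul_neg_iff.1 hlt with h' | h'
  · exact key x y h'.1 h'.2
  · exact key y x h'.2 h'.1

theorem mul_reflect_periodic {g : ℝ → ℝ} {T c : ℝ} (hc : c * c = 1)
    (hg : ∀ x, g (x + T) = c * g x) (x h : ℝ) :
    g (x + T - h) * g (x + T + h) = g (x - h) * g (x + h) := by
  rw [show x + T - h = x - h + T by ring, show x + T + h = x + h + T by ring, hg, hg]
  linear_combination g (x - h) * g (x + h) * hc

/-- Seen from `γ s`, a strictly convex curve turns positively. -/
theorem det2_chord_pos {T : ℝ} {γ : ℝ → ℝ × ℝ} (hγ : Differentiable ℝ γ)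
    (hconv : ∀ s u : ℝ, (¬ ∃ k : ℤ, u - s = k * T) → 0 < det2 (deriv γ s) (γ u - γ s))
    {s u v : ℝ} (hsu : s < u) (huv : u < v) (hv : v < s + T) :
    0 < det2 (γ u - γ s) (γ v - γ s) := by
  have hT : 0 < T := by linarith
  have hk : ∀ w : ℝ, 0 < w → w < T → ¬ ∃ k : ℤ, w = k * T := by
    rintro w h0 h1 ⟨k, rfl⟩
    have a1 : (0:ℝ) < k := pos_of_mul_pos_left h0 hT.le
    have a2 : (k:ℝ) < 1 := by nlinarith
    norm_cast at a1 a2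
    omega
  set n := deriv γ s with hn
  have hx : ∀ w ∈ Ioo s (s + T), 0 < det2 n (γ w - γ s) := fun w hw =>
    hconv s w (hk _ (by linarith [hw.1]) (by linarith [hw.2]))
  have hrot : ∀ w ∈ Ioo s (s + T), 0 < det2 (γ w - γ s) (deriv γ w) := by
    intro w hw
    have := hconv w s (by
      rintro ⟨k, h⟩
      refine hk (w - s) (by linarith [hw.1]) (by linarith [hw.2]) ⟨-k, ?_⟩
      push_cast
      linarith)
    simp only [det2, Prod.fst_sub, Prod.snd_sub] at this ⊢
    linarith
  have hnn : 0 < n.1 * n.1 + n.2 * n.2 := by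
    have := hx u ⟨hsu, by linarith⟩
    by_contra! hle
    have h1 : n.1 = 0 := by nlinarith [mul_self_nonneg n.1, mul_self_nonneg n.2]
    have h2 : n.2 = 0 := by nlinarith [mul_self_nonneg n.1, mul_self_nonneg n.2]
    simp [det2, h1, h2] at this
  set r : ℝ → ℝ := fun w => (n.1 * (γ w - γ s).1 + n.2 * (γ w - γ s).2) / det2 n (γ w - γ s)
    with hr
  have hder : ∀ w ∈ Ioo s (s + T), HasDerivAt r
      (-((n.1 * n.1 + n.2 * n.2) * det2 (γ w - γ s) (deriv γ w)) /
        (det2 n (γ w - γ s)) ^ 2) w := by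
    intro w hw
    have hd := (hγ w).hasDerivAt.sub_const (γ s)
    have h1 : HasDerivAt (fun w => (γ w - γ s).1) (deriv γ w).1 w := hd.fst
    have h2 : HasDerivAt (fun w => (γ w - γ s).2) (deriv γ w).2 w := hd.snd
    have := ((h1.const_mul n.1).add (h2.const_mul n.2)).div
      ((h2.const_mul n.1).sub (h1.const_mul n.2)) (hx w hw).ne'
    refine this.congr_deriv ?_
    simp only [det2, Pi.sub_apply, Pi.add_apply]
    congr 1
    ring
  have hanti : StrictAntiOn r (Ioo s (s + T)) := by
    refine strictAntiOn_of_deriv_neg (convex_Ioo _ _)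
      (fun w hw => (hder w hw).continuousAt.continuousWithinAt) fun w hw => ?_
    rw [interior_Ioo] at hw
    rw [(hder w hw).deriv]
    have := hx w hw
    have := hrot w hw
    exact div_neg_of_neg_of_pos (by nlinarith) (by positivity)
  have hu' : u ∈ Ioo s (s + T) := ⟨hsu, by linarith⟩
  have hv' : v ∈ Ioo s (s + T) := ⟨by linarith, hv⟩
  have := hanti hu' hv' huv
  rw [hr] at this
  simp only at this
  rw [div_lt_div_iff₀ (hx v hv') (hx u hu')] at this
  refine pos_of_mul_pos_right (a := n.1 * n.1 + n.2 * n.2) ?_ hnn.le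
  simp only [det2] at this ⊢
  linarith

/-- Two chords of a strictly convex curve with interlaced end points are not parallel. -/
theorem det2_crossing_chords_pos {T : ℝ} {γ : ℝ → ℝ × ℝ} (hγ : Differentiable ℝ γ)
    (hconv : ∀ s u : ℝ, (¬ ∃ k : ℤ, u - s = k * T) → 0 < det2 (deriv γ s) (γ u - γ s))
    {s u v w : ℝ} (hsu : s < u) (huv : u < v) (hvw : v < w) (hw : w < s + T) :
    0 < det2 (γ v - γ s) (γ w - γ u) := by
  have h1 := det2_chord_pos hγ hconv hsu huv (by linarith)
  have h2 := det2_chord_pos hγ hconv (hsu.trans huv) hvw hw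
  simp only [det2, Prod.fst_sub, Prod.snd_sub] at h1 h2 ⊢
  linarith

theorem continuous_det2 {X : Type*} [TopologicalSpace X] {p q : X → ℝ × ℝ} (hp : Continuous p)
    (hq : Continuous q) : Continuous fun x => det2 (p x) (q x) := by
  unfold det2
  fun_prop

theorem smooth_three_vertex_theorem
    (T₀ : ℝ) (hT₀ : 0 < T₀)
    (γ : ℝ → ℝ × ℝ) (hγ : ContDiff ℝ 1 γ)
    (hper : ∀ s, γ (s + 2 * T₀) = γ s)
    (hconv : ∀ s u : ℝ, (¬ ∃ k : ℤ, u - s = k * (2 * T₀)) →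
      0 < det2 (deriv γ s) (γ u - γ s))
    (a : ℝ) (ha : 0 < a)
    (hhalf : ∀ s, det2 (deriv γ s) (γ (s + T₀) - γ s) = a)
    (α : ℝ → ℝ) (hα : ∀ s, α s = det2 (deriv γ s) (deriv γ (s + T₀)))
    (hfin : {s ∈ Set.Ico (0:ℝ) (2 * T₀) | α s = 0}.Finite) :
    Odd {s₀ ∈ Set.Ico (0:ℝ) T₀ | α s₀ = 0 ∧
          ∃ ε > 0, ∀ h : ℝ, 0 < h → h < ε → α (s₀ - h) * α (s₀ + h) < 0}.ncard ∧
      3 ≤ {s₀ ∈ Set.Ico (0:ℝ) T₀ | α s₀ = 0 ∧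
          ∃ ε > 0, ∀ h : ℝ, 0 < h → h < ε → α (s₀ - h) * α (s₀ + h) < 0}.ncard := by
  have hdiff : Differentiable ℝ γ := hγ.differentiable one_ne_zero
  have hdc : Continuous (deriv γ) := hγ.continuous_deriv le_rfl
  have hper' : ∀ s, γ (s + T₀ + T₀) = γ s := fun s => by rw [← hper s]; congr 1; ring
  have hderper : ∀ s, deriv γ (s + T₀ + T₀) = deriv γ s := by
    intro s
    rw [add_assoc, ← deriv_comp_add_const]
    congr 1
    funext t
    rw [← add_assoc, hper']
  have hαc : Continuous α := by
    rw [funext hα]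
    exact continuous_det2 hdc (by fun_prop)
  have hαT : ∀ x, α (x + T₀) = (-1) * α x := by
    intro x
    rw [hα, hα, hderper]
    simp only [det2]
    ring
  set D : ℝ → ℝ × ℝ := fun s => γ (s + T₀) - γ s with hD
  have hDc : Continuous D := by
    have := hdiff.continuous
    fun_prop
  have hDT : ∀ x, D (x + T₀) = - D x := by
    intro x
    simp only [hD, hper', neg_sub]
  have hDpos : ∀ s x, s < x → x < s + T₀ → 0 < det2 (D s) (D x) := fun s x h1 h2 =>
    det2_crossing_chords_pos (T := 2 * T₀) hdiff hconv h1 h2 (by linarith) (by linarith)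
  set f : ℝ → ℝ → ℝ := fun s x => det2 (D s) (D x) with hf
  have hfc : ∀ s, Continuous (f s) := fun s => continuous_det2 continuous_const hDc
  have hfT : ∀ s x, f s (x + T₀) = (-1) * f s x := by
    intro s x
    simp only [hf, hDT, det2, Prod.fst_neg, Prod.snd_neg]
    ring
  have hfanti : ∀ s x, f s x = - f x s := by
    intro s x
    simp only [hf, det2]
    ring
  have hfsw : ∀ s, SwitchesSignAt (f s) s := by
    intro s
    refine switchesSignAt_iff.2 ⟨T₀, hT₀, fun h h0 h1 => ?_⟩
    rw [hfanti s (s - h)]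
    have h2 : 0 < f (s - h) s := hDpos _ _ (by linarith) (by linarith)
    have h3 : 0 < f s (s + h) := hDpos _ _ (by linarith) (by linarith)
    nlinarith
  have hfne : ∀ s ∈ Ico 0 T₀, ∀ x ∈ Ico 0 T₀, s ≠ x → f s x ≠ 0 := by
    intro s hs x hx hne
    rcases hne.lt_or_gt with h | h
    · exact (hDpos s x h (by linarith [hs.1, hx.2])).ne'
    · rw [hfanti]
      exact neg_ne_zero.2 (hDpos x s h (by linarith [hx.1, hs.2])).ne'
  have hisol : ∀ x, ∀ᶠ h in 𝓝[>] (0:ℝ), α (x - h) * α (x + h) ≠ 0 := by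
    have hp : Function.Periodic
        (fun x => ∀ᶠ h in 𝓝[>] (0:ℝ), α (x - h) * α (x + h) ≠ 0) T₀ := by
      intro x
      simp only [mul_reflect_periodic (by norm_num) hαT]
    intro x
    obtain ⟨y, hy, hxy⟩ := hp.exists_mem_Ico hT₀ x T₀
    rw [hxy]
    have hn : ∀ᶠ z in 𝓝[≠] y, α z ≠ 0 := by
      have h1 : ∀ᶠ z in 𝓝[≠] y, z ∉ {s ∈ Set.Ico (0:ℝ) (2 * T₀) | α s = 0} := by
        have := (hfin.subset (sdiff_subset (t := {y}))).isClosed.isOpen_compl.mem_nhds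
          (show y ∈ ({s ∈ Set.Ico (0:ℝ) (2 * T₀) | α s = 0} \ {y})ᶜ by simp)
        rw [eventually_nhdsWithin_iff]
        filter_upwards [this] with z hz hzy hz'
        exact hz ⟨hz', hzy⟩
      have h2 : ∀ᶠ z in 𝓝[≠] y, z ∈ Ioo 0 (2 * T₀) :=
        mem_nhdsWithin_of_mem_nhds (Ioo_mem_nhds (by linarith [hy.1]) (by linarith [hy.2]))
      filter_upwards [h1, h2] with z hz hz' h0
      exact hz ⟨⟨hz'.1.le, hz'.2⟩, h0⟩
    have t1 : Tendsto (fun h => y - h) (𝓝[>] (0:ℝ)) (𝓝[≠] y) := by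
      refine tendsto_nhdsWithin_iff.2 ⟨?_, ?_⟩
      · have : Continuous fun h : ℝ => y - h := by fun_prop
        simpa using (this.tendsto 0).mono_left nhdsWithin_le_nhds
      · filter_upwards [self_mem_nhdsWithin] with h hh
        simpa using ne_of_gt hh
    have t2 : Tendsto (fun h => y + h) (𝓝[>] (0:ℝ)) (𝓝[≠] y) := by
      refine tendsto_nhdsWithin_iff.2 ⟨?_, ?_⟩
      · have : Continuous fun h : ℝ => y + h := by fun_prop
        simpa using (this.tendsto 0).mono_left nhdsWithin_le_nhds
      · filter_upwards [self_mem_nhdsWithin] with h hh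
        simpa using ne_of_gt hh
    filter_upwards [t1.eventually hn, t2.eventually hn] with h h1 h2
    exact mul_ne_zero h1 h2
  set S := {s₀ ∈ Set.Ico (0:ℝ) T₀ | α s₀ = 0 ∧
          ∃ ε > 0, ∀ h : ℝ, 0 < h → h < ε → α (s₀ - h) * α (s₀ + h) < 0} with hS
  have hSfin : S.Finite :=
    hfin.subset fun s hs => ⟨⟨hs.1.1, by linarith [hs.1.2]⟩, hs.2.1⟩
  have hSmem : ∀ s ∈ Ico 0 T₀, SwitchesSignAt α s → s ∈ S := by
    intro s hs hsw
    refine ⟨hs, ?_, switchesSignAt_iff.1 hsw⟩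
    by_contra hne
    obtain ⟨h, h1, h2⟩ := (hsw.and (keepsSignAt_of_ne_zero hαc hne)).exists
    linarith
  set P := hSfin.toFinset with hP
  have hcard : S.ncard = P.card := Set.ncard_eq_toFinset_card S hSfin
  set g : ℝ → ℝ := fun x => α x * ∏ s ∈ P, f s x with hg
  have hgc : Continuous g := hαc.mul (continuous_finsetProd P fun s _ => hfc s)
  have hgT : ∀ x, g (x + T₀) = (-1) ^ (P.card + 1) * g x := by
    intro x
    simp only [hg, hαT, hfT, Finset.prod_mul_distrib, Finset.prod_const]
    ring
  have hkeep : ∀ x, KeepsSignAt g x := by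
    have hp : Function.Periodic (KeepsSignAt g) T₀ := by
      intro x
      simp only [KeepsSignAt]
      simp only [mul_reflect_periodic (by rw [← mul_pow]; norm_num) hgT]
    intro x
    obtain ⟨y, hy, hxy⟩ := hp.exists_mem_Ico₀ hT₀ x
    rw [hxy]
    have hother : ∀ s ∈ P, s ≠ y → KeepsSignAt (f s) y := fun s hs hne =>
      keepsSignAt_of_ne_zero (hfc s) (hfne s (hSfin.mem_toFinset.1 hs).1 y hy hne)
    by_cases hyS : y ∈ S
    · have hyP : y ∈ P := hSfin.mem_toFinset.2 hyS
      have h1 : SwitchesSignAt (fun x => f y x * ∏ s ∈ P.erase y, f s x) y :=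
        (hfsw y).mul_keepsSignAt (keepsSignAt_prod _ fun s hs =>
          hother s (Finset.mem_of_mem_erase hs) (Finset.ne_of_mem_erase hs))
      have h2 : SwitchesSignAt (fun x => ∏ s ∈ P, f s x) y := by
        refine h1.congr (Eventually.of_forall fun h => ?_)
        simp only [Finset.mul_prod_erase P (fun s => f s (y - h)) hyP,
          Finset.mul_prod_erase P (fun s => f s (y + h)) hyP]
      exact (switchesSignAt_iff.2 hyS.2.2).mul h2
    · have hk := (keepsSignAt_or_switchesSignAt hαc (hisol y)).resolve_right
        fun h => hyS (hSmem y hy h)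
      refine hk.mul (keepsSignAt_prod _ fun s hs => hother s hs ?_)
      rintro rfl
      exact hyS (hSfin.mem_toFinset.1 hs)
  have hsign := mul_nonneg_of_forall_keepsSignAt hgc hkeep
  obtain ⟨x₀, hx₀, hgx₀⟩ : ∃ x ∈ Ioo 0 T₀, g x ≠ 0 := by
    obtain ⟨h, h1, h2⟩ := ((hkeep (T₀ / 2)).and (Ioo_mem_nhdsGT (half_pos hT₀))).exists
    exact ⟨T₀ / 2 - h, ⟨by linarith [h2.2], by linarith [h2.1]⟩, left_ne_zero_of_mul h1.ne'⟩
  have hodd : Odd P.card := by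
    by_contra hne
    rw [Nat.not_odd_iff_even] at hne
    have h1 := hsign x₀ (x₀ + T₀)
    rw [hgT, hne.add_one.neg_one_pow] at h1
    nlinarith [mul_self_pos.2 hgx₀]
  have hne1 : P.card ≠ 1 := by
    intro h1
    obtain ⟨s, hs⟩ := Finset.card_eq_one.1 h1
    have hgs : ∀ x, g x = α x * f s x := fun x => by simp [hg, hs]
    have hval : ∀ x, HasDerivAt (fun y => a * det2 (D s) (γ y + γ (y + T₀))) (g x) x := by
      intro x
      have hd := (hdiff x).hasDerivAt.add ((hdiff (x + T₀)).hasDerivAt.comp_add_const x T₀)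
      have e1 : HasDerivAt (fun y => (γ y + γ (y + T₀)).1) _ x := hd.fst
      have e2 : HasDerivAt (fun y => (γ y + γ (y + T₀)).2) _ x := hd.snd
      refine (((e2.const_mul (D s).1).sub (e1.const_mul (D s).2)).const_mul a).congr_deriv ?_
      have k1 := hhalf x
      have k2 := hhalf (x + T₀)
      rw [hper'] at k2
      rw [hgs, hα]
      simp only [hf]
      rw [show D x = γ (x + T₀) - γ x from rfl]
      simp only [det2, Prod.fst_sub, Prod.snd_sub, Prod.fst_add, Prod.snd_add] at k1 k2 ⊢
      linear_combination
        (-((D s).1 * (deriv γ (x + T₀)).2 - (D s).2 * (deriv γ (x + T₀)).1)) * k1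
        - ((D s).1 * (deriv γ x).2 - (D s).2 * (deriv γ x).1) * k2
    have hint : ∫ x in (0:ℝ)..T₀, g x = 0 := by
      rw [intervalIntegral.integral_eq_sub_of_hasDerivAt (fun x _ => hval x)
        (hgc.intervalIntegrable _ _)]
      have := hper' 0
      rw [zero_add] at this
      rw [this, zero_add, add_comm (γ T₀), sub_self]
    have hpos : 0 < ∫ x in (0:ℝ)..T₀, g x₀ * g x :=
      intervalIntegral.integral_pos hT₀ (by fun_prop) (fun x _ => hsign x₀ x)
        ⟨x₀, ⟨hx₀.1.le, hx₀.2.le⟩, mul_self_pos.2 hgx₀⟩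
    rw [intervalIntegral.integral_const_mul, hint, mul_zero] at hpos
    exact lt_irrefl _ hpos
  rw [hcard]
  refine ⟨hodd, ?_⟩
  obtain ⟨k, hk⟩ := hodd
  omega
end

section
/- Let T₀ > 0 and let γ : ℝ → ℝ² be C¹ with γ(s + 2T₀) = γ(s) for all s, and assume there is a constant a with [γ'(s), γ(s+T₀) − γ(s)] = a for all s (half-area parameterization). Let c : ℝ → ℝ be differentiable with c(s + T₀) = c(s) for all s, and define γ̄(s) := c(s)·γ(s) + (1 − c(s))·γ(s + T₀). Then for all s: (1) [γ̄'(s), γ̄(s + T₀) − γ̄(s)] = (2c(s) − 1)² · a, and (2) (γ̄(s) + γ̄(s + T₀))/2 = (γ(s) + γ(s + T₀))/2, i.e. γ̄ has the same midpoint curve of chords as γ. -/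
theorem family_same_midpoint_curve
    (T₀ : ℝ) (hT₀ : 0 < T₀)
    (γ : ℝ → ℝ × ℝ) (hγ : ContDiff ℝ 1 γ)
    (hper : ∀ s, γ (s + 2 * T₀) = γ s)
    (a : ℝ)
    (hhalf : ∀ s, det2 (deriv γ s) (γ (s + T₀) - γ s) = a)
    (c : ℝ → ℝ) (hc : Differentiable ℝ c)
    (hcper : ∀ s, c (s + T₀) = c s)
    (γbar : ℝ → ℝ × ℝ)
    (hγbar : ∀ s, γbar s = c s • γ s + (1 - c s) • γ (s + T₀)) :
    ∀ s, det2 (deriv γbar s) (γbar (s + T₀) - γbar s) = (2 * c s - 1) ^ 2 * a ∧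
      ((1:ℝ) / 2) • (γbar s + γbar (s + T₀)) = ((1:ℝ) / 2) • (γ s + γ (s + T₀)) := by
  intro s
  have hγd : Differentiable ℝ γ := hγ.differentiable one_ne_zero
  have hshift : γ (s + T₀ + T₀) = γ s := by
    rw [← hper s]; congr 1; ring
  have hbar : γbar (s + T₀) = c s • γ (s + T₀) + (1 - c s) • γ s := by
    rw [hγbar, hcper, hshift]
  have hderiv : HasDerivAt γbar
      ((c s • deriv γ s + deriv c s • γ s) +
        ((1 - c s) • deriv γ (s + T₀) + (-deriv c s) • γ (s + T₀))) s := by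
    rw [funext hγbar]
    have hcs := (hc s).hasDerivAt
    exact (hcs.smul (hγd s).hasDerivAt).add
      ((hcs.const_sub 1).smul ((hγd (s + T₀)).hasDerivAt.comp_add_const s T₀))
  have h₀ := hhalf s
  have h₁ := hhalf (s + T₀)
  rw [hshift] at h₁
  refine ⟨?_, ?_⟩
  · rw [hderiv.deriv, hbar, hγbar s]
    simp only [det2, Prod.fst_add, Prod.snd_add, Prod.fst_sub, Prod.snd_sub,
      Prod.smul_fst, Prod.smul_snd, smul_eq_mul] at h₀ h₁ ⊢
    linear_combination (2 * c s - 1) * c s * h₀ - (2 * c s - 1) * (1 - c s) * h₁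
  · rw [hbar, hγbar s]
    module
end

section
/- Let T₀ > 0 and let γ : ℝ → ℝ² be C¹ with γ(s + 2T₀) = γ(s) for all s, and assume there is a constant a ≠ 0 with [γ'(s), γ(s+T₀) − γ(s)] = a for all s (half-area parameterization). Let c : ℝ → ℝ be differentiable with c(s + T₀) = c(s) for all s, define γ̄(s) := c(s)·γ(s) + (1 − c(s))·γ(s + T₀), and suppose the function s ↦ [γ̄'(s), γ̄(s + T₀) − γ̄(s)] is constant. Then c is constant. -/
/-- A differentiable real function whose square is constant is constant. -/
theorem const_of_sq_const {f : ℝ → ℝ} (hf : Differentiable ℝ f) {m : ℝ}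
    (hm : ∀ s, f s ^ 2 = m) (s₁ s₂ : ℝ) : f s₁ = f s₂ := by
  by_cases h0 : m = 0
  · have hz : ∀ s, f s = 0 := fun s => by simpa [h0] using hm s
    rw [hz, hz]
  · refine is_const_of_deriv_eq_zero hf (fun s => ?_) s₁ s₂
    have h1 : HasDerivAt (fun s => f s ^ 2) (2 * f s * deriv f s) s := by
      simpa using (hf s).hasDerivAt.fun_pow 2
    have h2 : HasDerivAt (fun s => f s ^ 2) 0 s := by
      simpa only [hm] using hasDerivAt_const s m
    have hne : f s ≠ 0 := fun h => h0 (by rw [← hm s, h]; norm_num)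
    simpa [hne] using h1.unique h2

theorem constant_weight_of_half_area_deformation
    (T₀ : ℝ) (hT₀ : 0 < T₀)
    (γ : ℝ → ℝ × ℝ) (hγ : ContDiff ℝ 1 γ)
    (hper : ∀ s, γ (s + 2 * T₀) = γ s)
    (a : ℝ) (ha : a ≠ 0)
    (hhalf : ∀ s, det2 (deriv γ s) (γ (s + T₀) - γ s) = a)
    (c : ℝ → ℝ) (hc : Differentiable ℝ c)
    (hcper : ∀ s, c (s + T₀) = c s)
    (γbar : ℝ → ℝ × ℝ)
    (hγbar : ∀ s, γbar s = c s • γ s + (1 - c s) • γ (s + T₀))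
    (hconst : ∃ k : ℝ, ∀ s, det2 (deriv γbar s) (γbar (s + T₀) - γbar s) = k) :
    ∀ s₁ s₂, c s₁ = c s₂ := by
  obtain ⟨k, hk⟩ := hconst
  have hγd : ∀ s, HasDerivAt γ (deriv γ s) s := fun s =>
    (hγ.differentiable one_ne_zero s).hasDerivAt
  have hper' : ∀ s, γ (s + T₀ + T₀) = γ s := fun s => by
    rw [← hper s]; congr 1; ring
  have hsq : ∀ s, (2 * c s - 1) ^ 2 = k / a := fun s => by
    have hcd := (hc s).hasDerivAt
    have hbar : HasDerivAt γbar
        ((c s • deriv γ s + deriv c s • γ s) +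
          ((1 - c s) • deriv γ (s + T₀) + (-deriv c s) • γ (s + T₀))) s := by
      rw [funext hγbar]
      exact (hcd.smul (hγd s)).add
        ((hcd.const_sub 1).smul ((hγd (s + T₀)).comp_add_const s T₀))
    have h := hk s
    have h₁ := hhalf s
    have h₂ := hhalf (s + T₀)
    rw [hbar.deriv, hγbar, hγbar, hcper, hper'] at h
    rw [hper'] at h₂
    simp only [det2, Prod.fst_add, Prod.snd_add, Prod.fst_sub, Prod.snd_sub, Prod.smul_fst,
      Prod.smul_snd, smul_eq_mul] at h h₁ h₂
    rw [eq_div_iff ha]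
    linear_combination h - (2 * c s - 1) * c s * h₁ + (2 * c s - 1) * (1 - c s) * h₂
  intro s₁ s₂
  have := const_of_sq_const ((hc.const_mul 2).sub_const 1) hsq s₁ s₂
  linarith
end

section
/- Let n ≥ 2 and let γ : ℤ → ℝ² satisfy γ(i + 2n) = γ(i) for all i. Then the following are equivalent: (i) for every i, Σ_{k=i}^{i+n−1} [γ(k), γ(k+1)] + [γ(i+n), γ(i)] = (1/2) Σ_{k=0}^{2n−1} [γ(k), γ(k+1)] (every principal diagonal γ(i)γ(i+n) divides the polygon into two parts of equal signed area); (ii) for every i, [γ(i+n+1) − γ(i), γ(i+n) − γ(i+1)] = 0 (the two central diagonals associated to each side are parallel); (iii) for every i, a⁺(i) = a⁻(i+n). -/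
/-- Twice the signed area of the polygon `γ i, …, γ (i + n)`. -/
noncomputable def chordArea (n : ℕ) (γ : ℤ → ℝ × ℝ) (i : ℤ) : ℝ :=
  (∑ k ∈ Finset.range n, det2 (γ (i + k)) (γ (i + k + 1))) + det2 (γ (i + n)) (γ i)

theorem chordArea_add_one_sub (n : ℕ) (γ : ℤ → ℝ × ℝ) (i : ℤ) :
    chordArea n γ (i + 1) - chordArea n γ i =
      -det2 (γ (i + n + 1) - γ i) (γ (i + n) - γ (i + 1)) := by
  have hsum : (∑ k ∈ Finset.range n, det2 (γ (i + 1 + k)) (γ (i + 1 + k + 1))) +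
      det2 (γ i) (γ (i + 1)) =
      (∑ k ∈ Finset.range n, det2 (γ (i + k)) (γ (i + k + 1))) +
        det2 (γ (i + n)) (γ (i + n + 1)) := by
    rw [← Finset.sum_range_succ (fun k : ℕ => det2 (γ (i + k)) (γ (i + k + 1))),
      Finset.sum_range_succ']
    simp only [Nat.cast_add, Nat.cast_one, Nat.cast_zero, add_zero, add_assoc, add_comm (1 : ℤ)]
  have hshift : i + 1 + (n : ℤ) = i + n + 1 := by ring
  simp only [chordArea, hshift]
  simp only [det2, Prod.fst_sub, Prod.snd_sub] at hsum ⊢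
  linear_combination hsum

theorem chordArea_zero_add_chordArea (n : ℕ) (γ : ℤ → ℝ × ℝ)
    (hper : ∀ i : ℤ, γ (i + 2 * n) = γ i) :
    chordArea n γ 0 + chordArea n γ n =
      ∑ k ∈ Finset.range (2 * n), det2 (γ k) (γ (k + 1)) := by
  have hclose : γ ((n : ℤ) + n) = γ 0 := by
    rw [← hper 0]
    congr 1
    ring
  rw [two_mul, Finset.sum_range_add]
  simp only [chordArea, hclose, zero_add, Nat.cast_add]
  simp only [det2]
  ring

theorem half_area_polygon_characterizations
    (n : ℕ) (hn : 2 ≤ n) (γ : ℤ → ℝ × ℝ)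
    (hper : ∀ i : ℤ, γ (i + 2 * n) = γ i)
    (v : ℤ → ℝ × ℝ) (hv : ∀ i, v i = γ (i + n) - γ i)
    (ap : ℤ → ℝ) (hap : ∀ i, ap i = det2 (γ (i + 1) - γ i) (v i))
    (am : ℤ → ℝ) (ham : ∀ i, am i = det2 (γ (i + 1) - γ i) (v (i + 1))) :
    ((∀ i : ℤ, (∑ k ∈ Finset.range n, det2 (γ (i + k)) (γ (i + k + 1))) +
        det2 (γ (i + n)) (γ i) =
        (1 / 2) * ∑ k ∈ Finset.range (2 * n), det2 (γ k) (γ (k + 1))) ↔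
      (∀ i : ℤ, det2 (γ (i + n + 1) - γ i) (γ (i + n) - γ (i + 1)) = 0)) ∧
    ((∀ i : ℤ, det2 (γ (i + n + 1) - γ i) (γ (i + n) - γ (i + 1)) = 0) ↔
      (∀ i : ℤ, ap i = am (i + n))) := by
  have hstep := chordArea_add_one_sub n γ
  have htot := chordArea_zero_add_chordArea n γ hper
  refine ⟨?_, forall_congr' fun i => ?_⟩
  · change (∀ i : ℤ, chordArea n γ i = _) ↔ _
    constructor
    · intro h i
      have := hstep i
      rw [h, h] at this
      linarith
    · intro h
      have hconst : ∀ i, chordArea n γ i = chordArea n γ 0 := by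
        have hp : Function.Periodic (chordArea n γ) 1 := fun i => by
          have := hstep i
          rw [h i] at this
          linarith
        intro i
        simpa using hp.int_mul_eq i
      intro i
      rw [hconst n] at htot
      rw [hconst i]
      linarith
  · have h₁ : γ (i + n + 1 + n) = γ (i + 1) := by
      rw [← hper (i + 1)]
      congr 1
      ring
    rw [hap, ham, hv, hv, h₁, ← sub_eq_zero (a := det2 (γ (i + 1) - γ i) _)]
    refine Eq.congr ?_ rfl
    simp only [det2, Prod.fst_sub, Prod.snd_sub]
    ring
end

section
/- Let n ≥ 2 and let γ : ℤ → ℝ² be a half-area 2n-polygon, i.e. γ(i+2n) = γ(i) and a⁺(i) = a⁻(i+n) for all i. Then for every i with a(i) ≠ 0: γ(i) + (a⁻(i)/a(i)) · v(i) = γ(i+1) + (a⁺(i)/a(i)) · v(i+1). (Hence this common point, the vertex 𝓔(i) of the discrete envelope, lies both on the principal diagonal line through γ(i) and γ(i+n) and on the principal diagonal line through γ(i+1) and γ(i+n+1).) -/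
theorem discrete_envelope_vertex_well_defined
    (n : ℕ) (hn : 2 ≤ n) (γ : ℤ → ℝ × ℝ)
    (hper : ∀ i : ℤ, γ (i + 2 * n) = γ i)
    (v : ℤ → ℝ × ℝ) (hv : ∀ i, v i = γ (i + n) - γ i)
    (ap : ℤ → ℝ) (hap : ∀ i, ap i = det2 (γ (i + 1) - γ i) (v i))
    (am : ℤ → ℝ) (ham : ∀ i, am i = det2 (γ (i + 1) - γ i) (v (i + 1)))
    (a : ℤ → ℝ) (ha : ∀ i, a i = ap i + am i)
    (hha : ∀ i : ℤ, ap i = am (i + n)) :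
    ∀ i : ℤ, a i ≠ 0 →
      γ i + (am i / a i) • v i = γ (i + 1) + (ap i / a i) • v (i + 1) := by
  intro i hi
  have h := hha i
  have h1 : i + n + 1 + n = i + 1 + 2 * n := by ring
  have h2 : i + n + n = i + 2 * n := by ring
  have h3 : i + n + 1 = i + 1 + n := by ring
  rw [hap, ham, hv (i + n + 1), h1, hper, h3, hv i] at h
  have hai := ha i
  rw [hap, ham, hv, hv] at hai
  rw [hap, ham, hv, hv]
  generalize a i = s at *
  generalize γ i = P at *
  generalize γ (i + 1) = Q at *
  generalize γ (i + n) = R at *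
  generalize γ (i + 1 + n) = S at *
  obtain ⟨p, p'⟩ := P
  obtain ⟨q, q'⟩ := Q
  obtain ⟨r, r'⟩ := R
  obtain ⟨t, t'⟩ := S
  simp only [det2, Prod.fst_sub, Prod.snd_sub] at h hai ⊢
  ext
  · simp only [Prod.fst_add, Prod.smul_fst, Prod.fst_sub, smul_eq_mul]
    field_simp
    linear_combination (p - q) * hai + (p - q) * h
  · simp only [Prod.snd_add, Prod.smul_snd, Prod.snd_sub, smul_eq_mul]
    field_simp
    linear_combination (p' - q') * hai + (p' - q') * h
end

section
/- Let n ≥ 2 and let γ : ℤ → ℝ² be a convex half-area 2n-polygon: γ(i+2n) = γ(i) for all i, γ is in strictly convex position positively oriented ([γ(i+1) − γ(i), γ(j) − γ(i)] > 0 for all i and all j not congruent to i or i+1 mod 2n), and a⁺(i) = a⁻(i+n) for all i. Define λ(i) := ‖γ(i+n) − γ(i+1)‖ / ‖γ(i+n+1) − γ(i)‖ and 𝓔(i) := γ(i) + (a⁻(i)/a(i))·v(i). Then for every i: 𝓔(i−1) = 𝓔(i) if and only if λ(i−1) · λ(i) = 1. -/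
/-- The Euclidean length of a vector in the plane. -/
noncomputable def elen (P : ℝ × ℝ) : ℝ := Real.sqrt (P.1 ^ 2 + P.2 ^ 2)

theorem elen_smul_div_elen {c : ℝ} (hc : 0 ≤ c) {u : ℝ × ℝ} (hu : u ≠ 0) :
    elen (c • u) / elen u = c := by
  have hpos : 0 < u.1 ^ 2 + u.2 ^ 2 := by
    by_contra! h
    apply hu
    ext <;> simp <;> nlinarith [sq_nonneg u.1, sq_nonneg u.2]
  have hsmul : elen (c • u) = c * elen u := by
    unfold elen
    rw [← Real.sqrt_sq hc, ← Real.sqrt_mul (sq_nonneg c), Real.sqrt_sq hc]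
    congr 1
    simp only [Prod.smul_fst, Prod.smul_snd, smul_eq_mul]
    ring
  rw [hsmul, mul_div_assoc, elen, div_self (Real.sqrt_pos.2 hpos).ne', mul_one]

/-- If the triangles `PAQ` and `QBA` have equal area, then the diagonals `AQ` and `PB` are
parallel, with ratio the quotient of the areas of `PAQ` and `PAB`. -/
theorem sub_eq_smul_sub_of_det2_eq {P A Q B : ℝ × ℝ}
    (h : det2 (A - P) (Q - P) = det2 (B - Q) (A - B)) (hB : det2 (A - P) (B - A) ≠ 0) :
    Q - A = (det2 (A - P) (Q - P) / det2 (A - P) (B - A)) • (B - P) := by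
  rw [div_eq_inv_mul, mul_smul, eq_inv_smul_iff₀ hB]
  simp only [det2, Prod.fst_sub, Prod.snd_sub] at h ⊢
  ext <;> simp only [Prod.smul_fst, Prod.smul_snd, Prod.fst_sub, Prod.snd_sub, smul_eq_mul]
  · linear_combination (P.1 - A.1) * h
  · linear_combination (P.2 - A.2) * h

theorem consecutive_envelope_vertices_coincide_iff
    (n : ℕ) (hn : 2 ≤ n) (γ : ℤ → ℝ × ℝ)
    (hper : ∀ i : ℤ, γ (i + 2 * n) = γ i)
    (hconv : ∀ i j : ℤ, ¬ ((2 * (n:ℤ)) ∣ (j - i)) → ¬ ((2 * (n:ℤ)) ∣ (j - (i + 1))) →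
      0 < det2 (γ (i + 1) - γ i) (γ j - γ i))
    (v : ℤ → ℝ × ℝ) (hv : ∀ i, v i = γ (i + n) - γ i)
    (ap : ℤ → ℝ) (hap : ∀ i, ap i = det2 (γ (i + 1) - γ i) (v i))
    (am : ℤ → ℝ) (ham : ∀ i, am i = det2 (γ (i + 1) - γ i) (v (i + 1)))
    (a : ℤ → ℝ) (ha : ∀ i, a i = ap i + am i)
    (hha : ∀ i : ℤ, ap i = am (i + n))
    (lam : ℤ → ℝ) (hlam : ∀ i, lam i = elen (γ (i + n) - γ (i + 1)) / elen (γ (i + n + 1) - γ i))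
    (E : ℤ → ℝ × ℝ) (hE : ∀ i, E i = γ i + (am i / a i) • v i) :
    ∀ i : ℤ, E (i - 1) = E i ↔ lam (i - 1) * lam i = 1 := by
  have hn' : (2 : ℤ) ≤ n := by exact_mod_cast hn
  have not_dvd {k : ℤ} (h0 : 0 < k) (h1 : k < 2 * n) : ¬ (2 * (n : ℤ)) ∣ k :=
    fun h => (Int.le_of_dvd h0 h).not_gt h1
  have hap_pos (i : ℤ) : 0 < ap i := by
    rw [hap, hv]
    exact hconv i (i + n) (not_dvd (by lia) (by lia)) (not_dvd (by lia) (by lia))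
  have ham_pos (i : ℤ) : 0 < am i := by
    have h := hconv i (i + n + 1) (not_dvd (by lia) (by lia)) (not_dvd (by lia) (by lia))
    rw [ham, hv, show i + 1 + n = i + n + 1 by ring]
    simp only [det2, Prod.fst_sub, Prod.snd_sub] at h ⊢
    linarith
  have hdiag (i : ℤ) : γ (i + n) - γ (i + 1) = (ap i / am i) • (γ (i + n + 1) - γ i) := by
    have h := hha i
    have hne := (ham_pos i).ne'
    rw [hap, ham, hv, hv, show i + n + 1 + n = i + 1 + 2 * n by ring, hper] at h
    rw [ham, hv, show i + 1 + n = i + n + 1 by ring] at hne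
    rw [hap, ham, hv, hv, show i + 1 + n = i + n + 1 by ring]
    exact sub_eq_smul_sub_of_det2_eq h hne
  have hratio (i : ℤ) : lam i = ap i / am i := by
    rw [hlam, hdiag]
    refine elen_smul_div_elen (div_pos (hap_pos i) (ham_pos i)).le fun h => ?_
    have hm := hconv i (i + n + 1) (not_dvd (by lia) (by lia)) (not_dvd (by lia) (by lia))
    simp [h, det2] at hm
  have hlam_pos (i : ℤ) : 0 < lam i := hratio i ▸ div_pos (hap_pos i) (ham_pos i)
  have hcoef (i : ℤ) : am i / a i = 1 / (1 + lam i) := by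
    have := ham_pos i
    have := hap_pos i
    rw [ha, hratio]
    field_simp
    ring
  intro i
  have hv_ne : v i ≠ 0 := fun h => by
    have := hap_pos i
    simp [hap, h, det2] at this
  have hl := hlam_pos i
  have hm := hlam_pos (i - 1)
  have hprev : E (i - 1) = γ i + (lam (i - 1) / (1 + lam (i - 1))) • v i := by
    have hd := hdiag (i - 1)
    rw [← hratio, show i - 1 + n + 1 = i + n by ring, sub_add_cancel] at hd
    rw [hE, hcoef, hv, hv, eq_add_of_sub_eq hd]
    ext <;> simp only [Prod.fst_add, Prod.snd_add, Prod.smul_fst, Prod.smul_snd, Prod.fst_sub,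
      Prod.snd_sub, smul_eq_mul] <;> field_simp <;> ring
  rw [hprev, hE, hcoef, add_right_inj, smul_left_inj hv_ne,
    div_eq_div_iff (by positivity) (by positivity)]
  constructor <;> intro h <;> linarith
end

section
/- Let n ≥ 2 and let γ : ℤ → ℝ² be a convex half-area 2n-polygon: γ(i+2n) = γ(i) for all i, γ is in strictly convex position positively oriented ([γ(i+1) − γ(i), γ(j) − γ(i)] > 0 for all i and all j not congruent to i or i+1 mod 2n), and a⁺(i) = a⁻(i+n) for all i. Define λ(i) := ‖γ(i+n) − γ(i+1)‖ / ‖γ(i+n+1) − γ(i)‖ and 𝓔(i) := γ(i) + (a⁻(i)/a(i))·v(i). Then the discrete envelope reduces to a single point (i.e. 𝓔(i) = 𝓔(i+1) for all i) if and only if γ is skew-symmetric, i.e. there exists c > 0 such that λ(i) = c for all even i and λ(i) = 1/c for all odd i. -/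
/-- The cyclic identity `[e,P] Q + [P,Q] e + [Q,e] P = 0` when `[P,Q] = 0`. -/
lemma smul_eq_smul_of_det2_eq_zero (e P Q : ℝ × ℝ) (h : det2 P Q = 0) :
    det2 e P • Q = det2 e Q • P := by
  unfold det2 at *
  ext <;> simp only [Prod.smul_fst, Prod.smul_snd, smul_eq_mul]
  · linear_combination -e.1 * h
  · linear_combination -e.2 * h

lemma elen_smul (k : ℝ) (P : ℝ × ℝ) : elen (k • P) = |k| * elen P := by
  unfold elen
  rw [← Real.sqrt_sq_eq_abs, ← Real.sqrt_mul (sq_nonneg k)]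
  congr 1
  simp only [Prod.smul_fst, Prod.smul_snd, smul_eq_mul]
  ring

lemma elen_pos {P : ℝ × ℝ} (h : P ≠ 0) : 0 < elen P := by
  refine Real.sqrt_pos.mpr ?_
  by_contra! hle
  exact h (Prod.ext (by simp; nlinarith [sq_nonneg P.1, sq_nonneg P.2])
    (by simp; nlinarith [sq_nonneg P.1, sq_nonneg P.2]))

lemma det2_zero_right (e : ℝ × ℝ) : det2 e 0 = 0 := by simp [det2]

/-- The diagonals of a trapezoid `A B C D` whose parallel sides are `BC` and `AD`. -/
lemma trapezoid_ratio {A B C D : ℝ × ℝ} (hC : 0 < det2 (B - A) (C - A))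
    (hD : 0 < det2 (B - A) (D - A)) (h : det2 (D - A) (C - B) = 0) :
    0 < elen (C - B) / elen (D - A) ∧
      C - B = (elen (C - B) / elen (D - A)) • (D - A) ∧
      det2 (B - A) (C - A) = elen (C - B) / elen (D - A) * det2 (B - A) (D - A) := by
  have hCA : det2 (B - A) (C - A) = det2 (B - A) (C - B) := by
    simp only [det2, Prod.fst_sub, Prod.snd_sub]; ring
  have hCB : 0 < det2 (B - A) (C - B) := hCA ▸ hC
  have hP : D - A ≠ 0 := fun h0 => by rw [h0, det2_zero_right] at hD; exact hD.false
  have hsmul := smul_eq_smul_of_det2_eq_zero (B - A) _ _ h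
  have hk : 0 < det2 (B - A) (C - B) / det2 (B - A) (D - A) := div_pos hCB hD
  have hQ : C - B = (det2 (B - A) (C - B) / det2 (B - A) (D - A)) • (D - A) := by
    rw [div_eq_inv_mul, mul_smul, ← hsmul, smul_smul, inv_mul_cancel₀ hD.ne', one_smul]
  have hratio : elen (C - B) / elen (D - A) = det2 (B - A) (C - B) / det2 (B - A) (D - A) := by
    conv_lhs => rw [hQ]
    rw [elen_smul, abs_of_pos hk, mul_div_cancel_right₀ _ (elen_pos hP).ne']
  rw [hratio]
  exact ⟨hk, hQ, by rw [hCA, div_mul_cancel₀ _ hD.ne']⟩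

lemma forall_mul_succ_eq_one_iff_alternating {l : ℤ → ℝ} (hpos : ∀ i, 0 < l i) :
    (∀ i, l i * l (i + 1) = 1) ↔
      ∃ c : ℝ, 0 < c ∧ ∀ i : ℤ, (Even i → l i = c) ∧ (Odd i → l i = 1 / c) := by
  constructor
  · intro h
    have hl : Function.Periodic l 2 := fun i => by
      have h1 := h i
      have h2 := h (i + 1)
      rw [add_assoc, one_add_one_eq_two, mul_comm] at h2
      exact mul_right_cancel₀ (hpos (i + 1)).ne' (h2.trans h1.symm)
    refine ⟨l 0, hpos 0, fun i => ⟨?_, ?_⟩⟩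
    · rintro ⟨r, rfl⟩
      simpa [← mul_two] using hl.int_mul r 0
    · rintro ⟨r, rfl⟩
      have h1 : l (2 * r + 1) = l 1 := by
        simpa [add_comm, mul_comm] using hl.int_mul r 1
      rw [h1, eq_div_iff (hpos 0).ne', mul_comm]
      simpa using h 0
  · rintro ⟨c, hc, h⟩ i
    rcases Int.even_or_odd i with hi | hi
    · rw [(h i).1 hi, (h _).2 hi.add_one, mul_one_div_cancel hc.ne']
    · rw [(h i).2 hi, (h _).1 hi.add_one, one_div_mul_cancel hc.ne']

theorem envelope_point_iff_skew_symmetric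
    (n : ℕ) (hn : 2 ≤ n) (γ : ℤ → ℝ × ℝ)
    (hper : ∀ i : ℤ, γ (i + 2 * n) = γ i)
    (hconv : ∀ i j : ℤ, ¬ ((2 * (n:ℤ)) ∣ (j - i)) → ¬ ((2 * (n:ℤ)) ∣ (j - (i + 1))) →
      0 < det2 (γ (i + 1) - γ i) (γ j - γ i))
    (v : ℤ → ℝ × ℝ) (hv : ∀ i, v i = γ (i + n) - γ i)
    (ap : ℤ → ℝ) (hap : ∀ i, ap i = det2 (γ (i + 1) - γ i) (v i))
    (am : ℤ → ℝ) (ham : ∀ i, am i = det2 (γ (i + 1) - γ i) (v (i + 1)))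
    (a : ℤ → ℝ) (ha : ∀ i, a i = ap i + am i)
    (hha : ∀ i : ℤ, ap i = am (i + n))
    (lam : ℤ → ℝ) (hlam : ∀ i, lam i = elen (γ (i + n) - γ (i + 1)) / elen (γ (i + n + 1) - γ i))
    (E : ℤ → ℝ × ℝ) (hE : ∀ i, E i = γ i + (am i / a i) • v i) :
    (∀ i : ℤ, E i = E (i + 1)) ↔
      ∃ c : ℝ, 0 < c ∧ ∀ i : ℤ, (Even i → lam i = c) ∧ (Odd i → lam i = 1 / c) := by
  have hn' : (2 : ℤ) ≤ n := by exact_mod_cast hn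
  have not_dvd : ∀ x : ℤ, 0 < x → x < 2 * n → ¬ (2 * (n : ℤ)) ∣ x := fun x h0 h1 hd =>
    absurd (Int.le_of_dvd h0 hd) (by lia)
  have hap_pos : ∀ i, 0 < det2 (γ (i + 1) - γ i) (γ (i + n) - γ i) := fun i =>
    hconv i _ (not_dvd _ (by lia) (by lia)) (not_dvd _ (by lia) (by lia))
  have ham_pos : ∀ i, 0 < det2 (γ (i + 1) - γ i) (γ (i + n + 1) - γ i) := fun i =>
    hconv i _ (not_dvd _ (by lia) (by lia)) (not_dvd _ (by lia) (by lia))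
  have ham' : ∀ i, am i = det2 (γ (i + 1) - γ i) (γ (i + n + 1) - γ i) := by
    intro i
    rw [ham, hv, show i + 1 + (n : ℤ) = i + n + 1 by ring]
    simp only [det2, Prod.fst_sub, Prod.snd_sub]
    ring
  have hpar : ∀ i, det2 (γ (i + n + 1) - γ i) (γ (i + n) - γ (i + 1)) = 0 := by
    intro i
    have h := hha i
    rw [hap, hv, ham', show i + (n : ℤ) + n + 1 = i + 1 + 2 * n by ring, hper] at h
    simp only [det2, Prod.fst_sub, Prod.snd_sub] at h ⊢
    linarith
  have htrap := fun i => trapezoid_ratio (hap_pos i) (ham_pos i) (hpar i)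
  simp only [← hlam] at htrap
  have hlam_pos : ∀ i, 0 < lam i := fun i => (htrap i).1
  have hEv : ∀ i, E i = γ i + (1 / (1 + lam i)) • v i := by
    intro i
    rw [hE, ha, hap, hv, (htrap i).2.2, ← ham']
    have h0 : am i ≠ 0 := by rw [ham']; exact (ham_pos i).ne'
    have h1 := hlam_pos i
    congr 2
    field_simp
    ring
  have hEv' : ∀ i, E i = γ (i + 1) + (lam i / (1 + lam i)) • v (i + 1) := by
    intro i
    have h1 := hlam_pos i
    have hQ := (htrap i).2.1
    rw [hEv, hv, hv, show i + 1 + (n : ℤ) = i + n + 1 by ring]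
    have hx := congrArg Prod.fst hQ
    have hy := congrArg Prod.snd hQ
    ext
    · simp only [Prod.fst_sub, Prod.fst_add, Prod.smul_fst, smul_eq_mul] at hx ⊢
      field_simp
      linear_combination hx
    · simp only [Prod.snd_sub, Prod.snd_add, Prod.smul_snd, smul_eq_mul] at hy ⊢
      field_simp
      linear_combination hy
  have hv0 : ∀ i, v i ≠ 0 := fun i h0 => by
    have h := hap_pos i
    rw [← hv, h0, det2_zero_right] at h
    exact h.false
  rw [← forall_mul_succ_eq_one_iff_alternating hlam_pos]
  refine forall_congr' fun i => ?_
  have h1 := hlam_pos i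
  have h2 := hlam_pos (i + 1)
  rw [hEv' i, hEv (i + 1), add_right_inj, (smul_left_injective ℝ (hv0 (i + 1))).eq_iff,
    div_eq_div_iff (by positivity) (by positivity)]
  constructor <;> intro h <;> linarith
end

section
/- Let n ≥ 2 and let γ : ℤ → ℝ² be a convex half-area 2n-polygon: γ(i+2n) = γ(i) for all i, γ is in strictly convex position positively oriented ([γ(i+1) − γ(i), γ(j) − γ(i)] > 0 for all i and all j not congruent to i or i+1 mod 2n), and a⁺(i) = a⁻(i+n) for all i. Define 𝓜(i) := (γ(i) + γ(i+n))/2 and 𝓔(i) := γ(i) + (a⁻(i)/a(i))·v(i). Then for every i: the midpoint 𝓜(i) lies outside the closed segment with endpoints 𝓔(i−1) and 𝓔(i) if and only if δ(i−1) · δ(i) < 0, i.e. if and only if γ(i) is a pt-vertex of γ. -/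
theorem notMem_uIcc_iff_mul_pos {x y c : ℝ} :
    c ∉ Set.uIcc x y ↔ 0 < (x - c) * (y - c) := by
  rw [Set.mem_uIcc, mul_pos_iff]
  grind

theorem add_smul_mem_segment_iff {V : Type*} [AddCommGroup V] [Module ℝ V]
    (P : V) {w : V} (hw : w ≠ 0) (x y c : ℝ) :
    P + c • w ∈ segment ℝ (P + x • w) (P + y • w) ↔ c ∈ Set.uIcc x y := by
  rw [mem_segment_translate, ← segment_eq_uIcc]
  have h := image_segment ℝ (LinearMap.toSpanSingleton ℝ V w).toAffineMap x y
  simp only [LinearMap.coe_toAffineMap, LinearMap.toSpanSingleton_apply] at h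
  rw [← h]
  exact (smul_left_injective ℝ hw).mem_set_image

/-- The intersection point of the lines `AC` and `BD`, written along either line. -/
theorem add_smul_eq_add_smul_of_det2 {A B C D : ℝ × ℝ} {p q : ℝ} (hpq : p + q ≠ 0)
    (hp : p = det2 (B - A) (C - A)) (hq : q = det2 (B - A) (D - B))
    (h : p + q = det2 (C - A) (D - B)) :
    A + (q / (p + q)) • (C - A) = B + (p / (p + q)) • (D - B) := by
  simp only [det2, Prod.fst_sub, Prod.snd_sub] at hp hq h
  ext <;> simp only [Prod.fst_add, Prod.snd_add, Prod.smul_fst, Prod.smul_snd, Prod.fst_sub,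
    Prod.snd_sub, smul_eq_mul] <;> field_simp
  · linear_combination (A.1 - B.1) * h + (C.1 - A.1) * hq - (D.1 - B.1) * hp
  · linear_combination (A.2 - B.2) * h + (C.2 - A.2) * hq - (D.2 - B.2) * hp

theorem midpoint_outside_segment_iff_pt_vertex
    (n : ℕ) (hn : 2 ≤ n) (γ : ℤ → ℝ × ℝ)
    (hper : ∀ i : ℤ, γ (i + 2 * n) = γ i)
    (hconv : ∀ i j : ℤ, ¬ ((2 * (n:ℤ)) ∣ (j - i)) → ¬ ((2 * (n:ℤ)) ∣ (j - (i + 1))) →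
      0 < det2 (γ (i + 1) - γ i) (γ j - γ i))
    (v : ℤ → ℝ × ℝ) (hv : ∀ i, v i = γ (i + n) - γ i)
    (ap : ℤ → ℝ) (hap : ∀ i, ap i = det2 (γ (i + 1) - γ i) (v i))
    (am : ℤ → ℝ) (ham : ∀ i, am i = det2 (γ (i + 1) - γ i) (v (i + 1)))
    (a : ℤ → ℝ) (ha : ∀ i, a i = ap i + am i)
    (δ : ℤ → ℝ) (hδ : ∀ i, δ i = det2 (γ (i + 1) - γ i) (γ (i + n + 1) - γ (i + n)))
    (hha : ∀ i : ℤ, ap i = am (i + n))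
    (M : ℤ → ℝ × ℝ) (hM : ∀ i, M i = ((1:ℝ) / 2) • (γ i + γ (i + n)))
    (E : ℤ → ℝ × ℝ) (hE : ∀ i, E i = γ i + (am i / a i) • v i) :
    ∀ i : ℤ, M i ∉ segment ℝ (E (i - 1)) (E i) ↔ δ (i - 1) * δ i < 0 := by
  have hap_pos : ∀ i, 0 < ap i := fun i ↦ by
    rw [hap, hv]
    apply hconv
    · rintro ⟨k, hk⟩
      have hk' : (n : ℤ) * (2 * k - 1) = 0 := by linarith
      rcases mul_eq_zero.mp hk' with h | h <;> omega
    · intro h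
      have := Int.le_of_dvd (by omega) h
      omega
  have ham_pos : ∀ i, 0 < am i := fun i ↦ by
    have h := hha (i + n)
    have hi : i + (n : ℤ) + n = i + 2 * n := by ring
    have hper' : γ (i + 2 * n + 1) = γ (i + 1) := by rw [← hper (i + 1)]; congr 1; ring
    have hper'' : γ (i + 2 * n + 1 + n) = γ (i + 1 + n) := by
      rw [← hper (i + 1 + n)]; congr 1; ring
    have : am (i + 2 * n) = am i := by rw [ham, ham, hv, hv, hper', hper'', hper]
    rw [← this, ← hi, ← h]
    exact hap_pos _
  have hδ' : ∀ i, δ i = am i - ap i := fun i ↦ by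
    have h : i + (n : ℤ) + 1 = i + 1 + n := by ring
    rw [hδ, ham, hap, hv, hv, h]
    simp only [det2, Prod.fst_sub, Prod.snd_sub]
    ring
  have hE' : ∀ i, E i = γ (i + 1) + (ap i / a i) • v (i + 1) := fun i ↦ by
    have ha_det : ap i + am i = det2 (γ (i + n) - γ i) (γ (i + 1 + n) - γ (i + 1)) := by
      have h := hha i
      have h1 : i + (n : ℤ) + 1 = i + 1 + n := by ring
      have h2 : γ (i + 1 + n + n) = γ (i + 1) := by rw [← hper (i + 1)]; congr 1; ring
      rw [ham, hv, h1, h2] at h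
      rw [h, ham, hv]
      simp only [det2, Prod.fst_sub, Prod.snd_sub]
      ring
    rw [hE, ha, hv, hv]
    exact add_smul_eq_add_smul_of_det2 (add_pos (hap_pos i) (ham_pos i)).ne'
      (by rw [hap, hv]) (by rw [ham, hv]) ha_det
  intro i
  have hv0 : v i ≠ 0 := fun h ↦ by
    have := hap_pos i
    simp [hap, h, det2] at this
  have hMi : M i = γ i + ((1 : ℝ) / 2) • v i := by
    rw [hM, hv]
    module
  have hEi := hE' (i - 1)
  rw [sub_add_cancel] at hEi
  rw [hMi, hEi, hE i, add_smul_mem_segment_iff _ hv0, notMem_uIcc_iff_mul_pos, hδ', hδ']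
  have h0 : 0 < a (i - 1) := ha (i - 1) ▸ add_pos (hap_pos _) (ham_pos _)
  have h1 : 0 < a i := ha i ▸ add_pos (hap_pos _) (ham_pos _)
  have key : (ap (i - 1) / a (i - 1) - 1 / 2) * (am i / a i - 1 / 2) =
      -((am (i - 1) - ap (i - 1)) * (am i - ap i)) / (4 * a (i - 1) * a i) := by
    field_simp
    rw [ha, ha]
    ring
  rw [key, div_pos_iff_of_pos_right (by positivity), neg_pos]
end

section
/- Let A, B, C, D ∈ ℝ² be, in this cyclic order, the vertices of a convex trapezoid with C − D = m·(B − A) for some 0 < m < 1 (so the sides AB and DC are parallel, with DC shorter), with A, B, D affinely independent. Then there exists exactly one point P in the open segment from B to C with the following property: letting Q be the intersection point of the line through B parallel to the line PD with the line through C parallel to the line PA, the point Q lies on the segment from A to D and Q − P is parallel to B − A. Moreover this unique P is P = B + (1/(1+√m))·(C − B). -/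
/-- Two vectors of the plane with nonzero determinant are linearly independent. -/
theorem eq_zero_of_smul_add_smul_eq_zero {e f : ℝ × ℝ} (h : det2 e f ≠ 0) {x y : ℝ}
    (hxy : x • e + y • f = 0) : x = 0 ∧ y = 0 := by
  have h₁ : x * e.1 + y * f.1 = 0 := by simpa using congrArg Prod.fst hxy
  have h₂ : x * e.2 + y * f.2 = 0 := by simpa using congrArg Prod.snd hxy
  constructor <;> refine (mul_eq_zero.mp ?_).resolve_right h <;> unfold det2
  · linear_combination f.2 * h₁ - f.1 * h₂
  · linear_combination e.1 * h₂ - e.2 * h₁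

theorem trapezoid_lemma
    (A B C D : ℝ × ℝ) (m : ℝ) (hm0 : 0 < m) (hm1 : m < 1)
    (hpar : C - D = m • (B - A))
    (hind : AffineIndependent ℝ ![A, B, D])
    (hconv₁ : 0 < det2 (B - A) (C - A))
    (hconv₂ : 0 < det2 (C - B) (D - B))
    (hconv₃ : 0 < det2 (D - C) (A - C))
    (hconv₄ : 0 < det2 (A - D) (B - D)) :
    ∀ P : ℝ × ℝ,
      (P ∈ openSegment ℝ B C ∧
        ∃ Q : ℝ × ℝ,
          (∃ t : ℝ, Q = B + t • (D - P)) ∧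
          (∃ u : ℝ, Q = C + u • (A - P)) ∧
          Q ∈ segment ℝ A D ∧
          (∃ r : ℝ, Q - P = r • (B - A)))
      ↔ P = B + (1 / (1 + Real.sqrt m)) • (C - B) := by
  have hef : det2 (B - A) (D - A) ≠ 0 := by
    have h : det2 (B - A) (D - A) = det2 (A - D) (B - D) := by
      simp only [det2, Prod.fst_sub, Prod.snd_sub]
      ring
    exact h ▸ hconv₄.ne'
  have hs : 0 < √m := Real.sqrt_pos.mpr hm0
  have hss : √m * √m = m := Real.mul_self_sqrt hm0.le
  obtain rfl : C = D + m • (B - A) := by rw [← hpar]; abel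
  intro P
  constructor
  · rintro ⟨⟨a, l, ha, hl, hal, rfl⟩, Q, ⟨t, ht⟩, -, ⟨c, s, -, -, hcs, rfl⟩, r, hr⟩
    obtain rfl : a = 1 - l := by linarith
    obtain rfl : c = 1 - s := by linarith
    have hrl := eq_zero_of_smul_add_smul_eq_zero hef
      (x := -(1 - l + l * m) - r) (y := s - l) (by linear_combination (norm := module) hr)
    have htl := eq_zero_of_smul_add_smul_eq_zero hef
      (x := t * (1 - l + l * m) - 1) (y := s - t * (1 - l)) (by linear_combination (norm := module) ht)
    have hsq : (1 - l) ^ 2 = (√m * l) ^ 2 := by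
      linear_combination (1 - l + l * m) * (hrl.2 - htl.2) - (1 - l) * htl.1 - l ^ 2 * hss
    have hlin : 1 - l = √m * l :=
      (sq_eq_sq₀ ha.le (mul_pos hs hl).le).mp hsq
    have hval : l = 1 / (1 + √m) := by
      rw [eq_div_iff (by positivity)]
      linarith
    rw [← hval]
    module
  · obtain ⟨l, hl⟩ : ∃ l, l = 1 / (1 + √m) := ⟨_, rfl⟩
    have hl0 : 0 < l := by rw [hl]; positivity
    have hlin : 1 - l = √m * l := by rw [hl]; field_simp; ring
    have hl1 : 0 < 1 - l := hlin ▸ mul_pos hs hl0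
    rw [← hl]
    rintro rfl
    have ht : (√m)⁻¹ * (1 - l) = l := by rw [hlin]; field_simp
    have hK : √m = 1 - l + l * m := by linear_combination (√m - 1) * hlin + l * hss
    have ht' : (√m)⁻¹ * (1 - l + l * m) = 1 := (inv_mul_eq_one₀ hs.ne').mpr hK
    refine ⟨⟨1 - l, l, hl1, hl0, by ring, by module⟩, A + l • (D - A), ⟨(√m)⁻¹, ?_⟩, ⟨√m, ?_⟩,
      ⟨1 - l, l, hl1.le, hl0.le, by ring, by module⟩, -(1 - l + l * m), by module⟩
    · linear_combination (norm := module) ht' • (B - A) - ht • (D - A)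
    · linear_combination (norm := module) (hss - √m * hK) • (B - A) - hlin • (D - A)
end

section
/- Let n ≥ 2 and let γ : ℤ → ℝ² be a half-area 2n-polygon, i.e. γ(i+2n) = γ(i) and a⁺(i) = a⁻(i+n) for all i, and assume a(i) ≠ 0 for all i. Then: (1) Σ_{i=0}^{2n−1} δ(i)/a(i) = 0, and (2) the vector-valued sum Σ_{i=0}^{2n−1} (δ(i)/a(i)) · (γ(i) + γ(i+1))/2 equals 0 ∈ ℝ². -/
/-- If `[u + w, s] = 0`, then `[u, s] (u + w) = [u, w] s`. -/
lemma det2_smul_add_eq {u w s : ℝ × ℝ} (h : det2 u s + det2 w s = 0) :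
    det2 u s • (u + w) = det2 u w • s := by
  simp only [det2] at h ⊢
  ext
  · simp only [Prod.smul_fst, Prod.fst_add, smul_eq_mul]
    linear_combination u.1 * h
  · simp only [Prod.smul_snd, Prod.snd_add, smul_eq_mul]
    linear_combination u.2 * h

lemma sum_range_two_mul_eq_sum_add {M : Type*} [AddCommMonoid M] (f : ℤ → M) (n : ℕ) :
    ∑ i ∈ Finset.range (2 * n), f i = ∑ i ∈ Finset.range n, (f i + f (i + n)) := by
  rw [two_mul, Finset.sum_range_add, Finset.sum_add_distrib]
  congr 1
  refine Finset.sum_congr rfl fun i _ => ?_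
  push_cast
  rw [add_comm]

theorem sums_of_g_and_g_times_midpoints_vanish
    (n : ℕ) (hn : 2 ≤ n) (γ : ℤ → ℝ × ℝ)
    (hper : ∀ i : ℤ, γ (i + 2 * n) = γ i)
    (v : ℤ → ℝ × ℝ) (hv : ∀ i, v i = γ (i + n) - γ i)
    (ap : ℤ → ℝ) (hap : ∀ i, ap i = det2 (γ (i + 1) - γ i) (v i))
    (am : ℤ → ℝ) (ham : ∀ i, am i = det2 (γ (i + 1) - γ i) (v (i + 1)))
    (a : ℤ → ℝ) (ha : ∀ i, a i = ap i + am i)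
    (δ : ℤ → ℝ) (hδ : ∀ i, δ i = det2 (γ (i + 1) - γ i) (γ (i + n + 1) - γ (i + n)))
    (hha : ∀ i : ℤ, ap i = am (i + n))
    (hanz : ∀ i : ℤ, a i ≠ 0) :
    (∑ i ∈ Finset.range (2 * n), δ i / a i = 0) ∧
    (∑ i ∈ Finset.range (2 * n), (δ i / a i) • (((1:ℝ) / 2) • (γ i + γ (i + 1))) =
      (0 : ℝ × ℝ)) := by
  have hshift (i : ℤ) : γ (i + n + n) = γ i := by rw [← hper i]; congr 1; ring
  have hshift' (i : ℤ) : γ (i + n + 1 + n) = γ (i + 1) := by rw [← hper (i + 1)]; congr 1; ring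
  have hcomm (i : ℤ) : γ (i + 1 + n) = γ (i + n + 1) := by congr 1; ring
  have ha_shift (i : ℤ) : a (i + n) = a i := by
    have h : ap (i + n) = am i := by
      have h₁ : γ (i + n + n + 1) = γ (i + 1) := by rw [← hper (i + 1)]; congr 1; ring
      have h₂ : γ (i + n + n + 1 + n) = γ (i + 1 + n) := by
        rw [← hper (i + 1 + n)]; congr 1; ring
      rw [hha, ham, ham, hv, hv, hshift, h₁, h₂]
    rw [ha, ha, h, ← hha i, add_comm]
  have hδ_shift (i : ℤ) : δ (i + n) = -δ i := by
    have h : γ (i + n + n + 1) = γ (i + 1) := by rw [← hper (i + 1)]; congr 1; ring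
    rw [hδ, hδ, hshift, h]
    simp only [det2]
    ring
  have hdir (i : ℤ) : (δ i / a i) • (v i + v (i + 1)) =
      (γ (i + 1) - γ i) + (γ (i + n + 1) - γ (i + n)) := by
    have hai : a i = det2 (γ (i + 1) - γ i) (v i + v (i + 1)) := by
      rw [ha, hap, ham]; simp only [det2, Prod.fst_add, Prod.snd_add]; ring
    have hai' : a (i + n) = -det2 (γ (i + n + 1) - γ (i + n)) (v i + v (i + 1)) := by
      rw [ha, hap, ham, hv, hv, hv, hv, hshift, hshift', hcomm]
      simp only [det2, Prod.fst_add, Prod.snd_add, Prod.fst_sub, Prod.snd_sub]; ring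
    have h := det2_smul_add_eq (u := γ (i + 1) - γ i) (w := γ (i + n + 1) - γ (i + n))
      (s := v i + v (i + 1)) (by rw [← hai]; linarith [ha_shift i])
    rw [← hai, ← hδ] at h
    rw [div_eq_inv_mul, mul_smul, ← h, inv_smul_smul₀ (hanz i)]
  constructor
  · rw [sum_range_two_mul_eq_sum_add (fun i => δ i / a i)]
    refine Finset.sum_eq_zero fun i _ => ?_
    rw [hδ_shift, ha_shift]
    ring
  · rw [sum_range_two_mul_eq_sum_add (fun i => (δ i / a i) • (((1:ℝ) / 2) • (γ i + γ (i + 1))))]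
    have hterm (i : ℕ) : (δ i / a i) • (((1:ℝ) / 2) • (γ i + γ (i + 1))) +
        (δ (i + n) / a (i + n)) • (((1:ℝ) / 2) • (γ (i + n) + γ (i + n + 1))) =
        (-(1:ℝ) / 2) • ((γ ((i + 1 : ℕ) : ℤ) + γ ((i + 1 : ℕ) + n)) - (γ i + γ (i + n))) := by
      have h := hdir i
      rw [hv, hv, hcomm] at h
      rw [hδ_shift, ha_shift]
      push_cast
      rw [hcomm]
      linear_combination (norm := module) (-(1:ℝ) / 2) • h
    simp only [hterm]
    rw [← Finset.smul_sum, Finset.sum_range_sub (fun k : ℕ => γ k + γ (k + n))]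
    have h0 : γ (n + n) = γ 0 := by simpa using hshift 0
    simp [h0, add_comm]
end

section
/- Let n ≥ 2 and let γ : ℤ → ℝ² be a convex half-area 2n-polygon: γ(i+2n) = γ(i) for all i, γ is in strictly convex position positively oriented ([γ(i+1) − γ(i), γ(j) − γ(i)] > 0 for all i and all j not congruent to i or i+1 mod 2n), and a⁺(i) = a⁻(i+n) for all i. Assume δ(i) ≠ 0 for all i. Then the number of indices i ∈ {1, …, n} with δ(i−1) · δ(i) < 0 (i.e. the number of pt-vertices among γ(1), …, γ(n)) is odd and at least 3. -/
/-- The Plücker relation for four vectors in the plane. -/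
lemma det2_plucker (a b c d : ℝ × ℝ) :
    det2 a b * det2 c d - det2 a c * det2 b d + det2 a d * det2 b c = 0 := by
  simp only [det2]; ring

/-- If the planar vectors `p 1, …, p (m - 1)` lie strictly to the left of `p 0` and each turns
left to its successor, then any two of them are positively oriented. -/
lemma det2_pos_of_consecutive (p : ℕ → ℝ × ℝ) (m : ℕ)
    (h0 : ∀ k, 0 < k → k < m → 0 < det2 (p 0) (p k))
    (hs : ∀ k, k + 1 < m → 0 < det2 (p k) (p (k + 1)))
    {b c : ℕ} (hbc : b < c) (hc : c < m) : 0 < det2 (p b) (p c) := by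
  induction c, hbc using Nat.le_induction with
  | base => exact hs b hc
  | succ c hbc ih =>
    have hbc' : b < c := hbc
    rcases Nat.eq_zero_or_pos b with rfl | hb
    · exact h0 _ (by omega) hc
    have h1 := mul_pos (h0 b hb (by omega)) (hs c hc)
    have h2 := mul_pos (h0 (c + 1) (by omega) hc) (ih (by omega))
    have hpl := det2_plucker (p 0) (p b) (p c) (p (c + 1))
    have h3 : 0 < det2 (p 0) (p c) * det2 (p b) (p (c + 1)) := by linarith
    exact pos_of_mul_pos_right h3 (h0 c (by omega) (by omega)).le

/-- A closed polygon lying strictly to the left of each of its edges is in strictly convex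
position: any three distinct vertices in cyclic order are positively oriented. -/
lemma det2_vertices_pos {N : ℤ} {γ : ℤ → ℝ × ℝ}
    (hconv : ∀ i j : ℤ, ¬ (N ∣ (j - i)) → ¬ (N ∣ (j - (i + 1))) →
      0 < det2 (γ (i + 1) - γ i) (γ j - γ i))
    {a b c : ℤ} (hab : a < b) (hbc : b < c) (hca : c < a + N) :
    0 < det2 (γ b - γ a) (γ c - γ a) := by
  have ndvd : ∀ x : ℤ, 0 < x → x < N → ¬ (N ∣ x) := fun x h1 h2 h =>
    absurd (Int.le_of_dvd h1 h) (by omega)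
  have key := det2_pos_of_consecutive (fun k : ℕ => γ (a + 1 + k) - γ a) (N - 1).toNat
    (fun k hk hkm => by
      simpa using hconv a (a + 1 + k) (ndvd _ (by omega) (by omega)) (ndvd _ (by omega) (by omega)))
    (fun k hk => by
      have h := hconv (a + 1 + k) a
        (fun h => ndvd (1 + k) (by omega) (by omega) (by
          rwa [← dvd_neg, show -(1 + (k : ℤ)) = a - (a + 1 + k) by ring]))
        (fun h => ndvd (2 + k) (by omega) (by omega) (by
          rwa [← dvd_neg, show -(2 + (k : ℤ)) = a - (a + 1 + k + 1) by ring]))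
      have e : a + 1 + ((k + 1 : ℕ) : ℤ) = a + 1 + k + 1 := by push_cast; ring
      simp only [e]
      convert h using 1
      simp only [det2, Prod.fst_sub, Prod.snd_sub]; ring)
    (b := (b - a - 1).toNat) (c := (c - a - 1).toNat) (by omega) (by omega)
  have eb : a + 1 + ((b - a - 1).toNat : ℤ) = b := by omega
  have ec : a + 1 + ((c - a - 1).toNat : ℤ) = c := by omega
  simpa only [eb, ec] using key

/-- Crossing diagonals of a convex polygon are positively oriented. -/
lemma det2_diagonals_pos {N : ℤ} {γ : ℤ → ℝ × ℝ}
    (hconv : ∀ i j : ℤ, ¬ (N ∣ (j - i)) → ¬ (N ∣ (j - (i + 1))) →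
      0 < det2 (γ (i + 1) - γ i) (γ j - γ i))
    {a b c d : ℤ} (hab : a < b) (hbc : b < c) (hcd : c < d) (hda : d < a + N) :
    0 < det2 (γ c - γ a) (γ d - γ b) := by
  have h1 := det2_vertices_pos hconv hab hbc (by omega)
  have h2 := det2_vertices_pos hconv (hab.trans hbc) hcd hda
  simp only [det2, Prod.fst_sub, Prod.snd_sub] at *
  linarith

/-- The number of sign changes of a nowhere vanishing sequence has the parity given by the signs
of its end terms. -/
lemma sign_changes_parity (f : ℤ → ℝ) (hf : ∀ i, f i ≠ 0) (m : ℕ) :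
    0 < (-1 : ℝ) ^ ((Finset.Icc (1 : ℤ) m).filter fun i => f (i - 1) * f i < 0).card *
      (f 0 * f m) := by
  induction m with
  | zero => simpa using hf 0
  | succ m ih =>
    have hI : Finset.Icc (1 : ℤ) ((m + 1 : ℕ) : ℤ) =
        insert ((m : ℤ) + 1) (Finset.Icc (1 : ℤ) m) := by
      ext x; simp only [Finset.mem_Icc, Finset.mem_insert]; omega
    have hm : 0 < f m ^ 2 := by have := hf m; positivity
    rw [hI, Finset.filter_insert]
    push_cast
    rw [add_sub_cancel_right]
    split_ifs with h
    · rw [Finset.card_insert_of_notMem (by simp), pow_succ]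
      have := mul_pos ih (neg_pos.2 h)
      refine pos_of_mul_pos_left (b := f m ^ 2) ?_ hm.le
      convert this using 1; ring
    · have h' : 0 < f m * f (m + 1) :=
        lt_of_le_of_ne (not_lt.1 h) (mul_ne_zero (hf _) (hf _)).symm
      have := mul_pos ih h'
      refine pos_of_mul_pos_left (b := f m ^ 2) ?_ hm.le
      convert this using 1; ring

/-- If no sign change occurs after `i` up to `i + m`, all terms there have the sign of `f i`. -/
lemma mul_pos_of_consecutive (f : ℤ → ℝ) (hf : ∀ i, f i ≠ 0) (i : ℤ) (m : ℕ)
    (h : ∀ k : ℕ, k + 1 < m → 0 < f (i + k) * f (i + k + 1)) :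
    ∀ k : ℕ, k < m → 0 < f i * f (i + k) := by
  intro k
  induction k with
  | zero => intro _; simpa using hf i
  | succ k ih =>
    intro hk
    have hp : 0 < f (i + k) ^ 2 := by have := hf (i + k); positivity
    have := mul_pos (ih (by omega)) (h k hk)
    refine pos_of_mul_pos_left (b := f (i + k) ^ 2) ?_ hp.le
    push_cast
    rw [← add_assoc]
    convert this using 1; ring

/-- For a convex half-area polygon, `δ` does not have constant sign on `n` consecutive indices. -/
lemma not_forall_delta_mul_pos
    (n : ℕ) (hn : 2 ≤ n) (γ : ℤ → ℝ × ℝ)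
    (hper : ∀ i : ℤ, γ (i + 2 * n) = γ i)
    (hconv : ∀ i j : ℤ, ¬ ((2 * (n:ℤ)) ∣ (j - i)) → ¬ ((2 * (n:ℤ)) ∣ (j - (i + 1))) →
      0 < det2 (γ (i + 1) - γ i) (γ j - γ i))
    (hha : ∀ i : ℤ, det2 (γ (i + 1) - γ i) (γ (i + n) - γ i) =
      det2 (γ (i + n + 1) - γ (i + n)) (γ (i + 1) - γ (i + n + 1)))
    (i : ℤ) (s : ℝ) :
    ¬ ∀ k : ℕ, k < n →
      0 < s * det2 (γ (i + k + 1) - γ (i + k)) (γ (i + k + n + 1) - γ (i + k + n)) := by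
  intro h
  have hdiag : ∀ a b : ℤ, a < b → b < a + n →
      0 < det2 (γ (a + n) - γ a) (γ (b + n) - γ b) := fun a b h1 h2 =>
    det2_diagonals_pos hconv h1 h2 (by omega) (by omega)
  set x := γ (i + n) - γ i with hx
  have hend : γ (i + n + n) - γ (i + n) = -x := by
    have : γ (i + n + n) = γ i := by rw [← hper i]; congr 1; ring
    rw [this, hx]; abel
  have hself : det2 x x = 0 := by simp only [det2]; ring
  -- `x` pairs nonnegatively with each diagonal from `i` to `i + n`, and positively in between
  have hxw : ∀ k : ℕ, k < n → 0 < det2 x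
      ((γ (i + k + n) - γ (i + k)) + (γ (i + k + 1 + n) - γ (i + k + 1))) := by
    intro k hk
    have hadd : ∀ y z, det2 x (y + z) = det2 x y + det2 x z := fun y z => by
      simp only [det2, Prod.fst_add, Prod.snd_add]; ring
    rw [hadd]
    rcases Nat.eq_zero_or_pos k with rfl | hk0
    · have := hdiag i (i + 1) (by omega) (by omega)
      simpa [← hx, hself] using this
    have h1 := hdiag i (i + k) (by omega) (by omega)
    rcases eq_or_lt_of_le (Nat.succ_le_of_lt hk) with hkn | hkn
    · have e : i + k + 1 = i + n := by omega
      have hneg : det2 x (-x) = 0 := by simp only [det2, Prod.fst_neg, Prod.snd_neg]; ring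
      rw [e, hend, hneg, add_zero]
      exact h1
    · exact add_pos h1 (hdiag i (i + k + 1) (by omega) (by omega))
  -- the steps of (twice) the midpoint curve, which closes up after `n` steps
  let g : ℕ → ℝ := fun k => det2 x (γ (i + k) + γ (i + k + n))
  have hstep : ∀ k ∈ Finset.range n, 0 < s * (g (k + 1) - g k) := by
    intro k hk
    have hk := Finset.mem_range.1 hk
    have hc := hdiag (i + k) (i + k + 1) (by omega) (by omega)
    have hprod := mul_pos (h k hk) (hxw k hk)
    have e := hha (i + k)
    have e1 : i + ((k + 1 : ℕ) : ℤ) = i + k + 1 := by push_cast; ring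
    have e2 : i + k + n + 1 = i + k + 1 + n := by ring
    refine pos_of_mul_pos_left (b := det2 (γ (i + k + n) - γ (i + k))
      (γ (i + k + 1 + n) - γ (i + k + 1))) ?_ hc.le
    simp only [g, e1]
    rw [e2] at hprod e
    generalize γ (i + k) = A at *
    generalize γ (i + k + n) = B at *
    generalize γ (i + k + 1) = C at *
    generalize γ (i + k + 1 + n) = D at *
    convert hprod using 1
    have hpl := det2_plucker x (C + D - A - B) (B - A + (D - C)) (D - C - (B - A))
    simp only [det2, Prod.fst_add, Prod.snd_add, Prod.fst_sub, Prod.snd_sub] at *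
    linear_combination (s / 2) * hpl -
      s * (x.1 * (D.2 - C.2 - (B.2 - A.2)) - x.2 * (D.1 - C.1 - (B.1 - A.1))) * e
  have hsum : 0 < ∑ k ∈ Finset.range n, s * (g (k + 1) - g k) :=
    Finset.sum_pos hstep ⟨0, by simp; omega⟩
  have hclosed : g n = g 0 := by
    have : γ (i + n + n) = γ i := by rw [← hper i]; congr 1; ring
    simp only [g, Nat.cast_zero, add_zero, this]
    rw [add_comm]
  rw [← Finset.mul_sum, Finset.sum_range_sub, hclosed, sub_self, mul_zero] at hsum
  exact lt_irrefl _ hsum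

theorem discrete_three_vertex_theorem
    (n : ℕ) (hn : 2 ≤ n) (γ : ℤ → ℝ × ℝ)
    (hper : ∀ i : ℤ, γ (i + 2 * n) = γ i)
    (hconv : ∀ i j : ℤ, ¬ ((2 * (n:ℤ)) ∣ (j - i)) → ¬ ((2 * (n:ℤ)) ∣ (j - (i + 1))) →
      0 < det2 (γ (i + 1) - γ i) (γ j - γ i))
    (v : ℤ → ℝ × ℝ) (hv : ∀ i, v i = γ (i + n) - γ i)
    (ap : ℤ → ℝ) (hap : ∀ i, ap i = det2 (γ (i + 1) - γ i) (v i))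
    (am : ℤ → ℝ) (ham : ∀ i, am i = det2 (γ (i + 1) - γ i) (v (i + 1)))
    (δ : ℤ → ℝ) (hδ : ∀ i, δ i = det2 (γ (i + 1) - γ i) (γ (i + n + 1) - γ (i + n)))
    (hha : ∀ i : ℤ, ap i = am (i + n))
    (hδnz : ∀ i : ℤ, δ i ≠ 0) :
    Odd {i : ℤ | 1 ≤ i ∧ i ≤ n ∧ δ (i - 1) * δ i < 0}.ncard ∧
      3 ≤ {i : ℤ | 1 ≤ i ∧ i ≤ n ∧ δ (i - 1) * δ i < 0}.ncard := by
  have hset : {i : ℤ | 1 ≤ i ∧ i ≤ n ∧ δ (i - 1) * δ i < 0} =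
      ((Finset.Icc (1 : ℤ) n).filter fun i => δ (i - 1) * δ i < 0 : Finset ℤ) := by
    ext i; simp [and_assoc]
  rw [hset, Set.ncard_coe_finset]
  have hanti : ∀ i, δ (i + n) = -δ i := by
    intro i
    have e1 : γ (i + n + n) = γ i := by rw [← hper i]; congr 1; ring
    have e2 : γ (i + n + n + 1) = γ (i + 1) := by rw [← hper (i + 1)]; congr 1; ring
    rw [hδ, hδ, e1, e2]
    simp only [det2]; ring
  have hodd : Odd ((Finset.Icc (1 : ℤ) n).filter fun i => δ (i - 1) * δ i < 0).card := by
    by_contra hev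
    have hpar := sign_changes_parity δ hδnz n
    have hn0 := hanti 0
    rw [zero_add] at hn0
    rw [(Nat.not_odd_iff_even.1 hev).neg_one_pow, hn0] at hpar
    nlinarith [sq_nonneg (δ 0)]
  refine ⟨hodd, ?_⟩
  have hne : ((Finset.Icc (1 : ℤ) n).filter fun i => δ (i - 1) * δ i < 0).card ≠ 1 := by
    intro hone
    obtain ⟨i, hi⟩ := Finset.card_eq_one.1 hone
    have himem : i ∈ Finset.Icc (1 : ℤ) n :=
      (Finset.mem_filter.1 (hi ▸ Finset.mem_singleton_self i)).1
    rw [Finset.mem_Icc] at himem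
    have hsame : ∀ j : ℤ, 1 ≤ j → j ≤ n → j ≠ i → 0 < δ (j - 1) * δ j := by
      intro j h1 h2 h3
      refine lt_of_le_of_ne (not_lt.1 fun hlt => h3 ?_) (mul_ne_zero (hδnz _) (hδnz _)).symm
      rw [← Finset.mem_singleton, ← hi, Finset.mem_filter, Finset.mem_Icc]
      exact ⟨⟨h1, h2⟩, hlt⟩
    have hcons : ∀ k : ℕ, k + 1 < n → 0 < δ (i + k) * δ (i + k + 1) := by
      intro k hk
      rcases le_or_gt (i + k + 1) n with hle | hgt
      · simpa using hsame (i + k + 1) (by omega) hle (by omega)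
      · have h := hsame (i + k + 1 - n) (by omega) (by omega) (by omega)
        have e1 := hanti (i + k + 1 - n - 1)
        have e2 := hanti (i + k + 1 - n)
        rw [show i + k + 1 - n - 1 + n = i + k by ring] at e1
        rw [sub_add_cancel] at e2
        rwa [e1, e2, neg_mul_neg]
    refine not_forall_delta_mul_pos n hn γ hper hconv (fun j => ?_) i (δ i) fun k hk => ?_
    · have h := hha j
      have e : γ (j + n + 1 + n) = γ (j + 1) := by rw [← hper (j + 1)]; congr 1; ring
      rwa [hap, ham, hv, hv, e] at h
    · rw [← hδ]
      exact mul_pos_of_consecutive δ hδnz i n hcons k hk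
  obtain ⟨t, ht⟩ := hodd
  omega
end

section
/- Let n ≥ 2 and let γ : ℤ → ℝ² be a half-area 2n-polygon, i.e. γ(i+2n) = γ(i) and a⁺(i) = a⁻(i+n) for all i, and assume δ(i) ≠ 0 for all i (no side of γ is parallel to its opposite side). Let c : ℤ → ℝ satisfy c(i+n) = c(i) for all i, and define γ̄(i) := (1 − c(i))·γ(i) + c(i)·γ(i+n), with ā⁺, ā⁻ defined from γ̄ in the same way as a⁺, a⁻ are defined from γ. Then γ̄ is half-area (i.e. ā⁺(i) = ā⁻(i+n) for all i) if and only if c is constant. -/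
/-- For a half-area polygon, the defect of the half-area condition after moving the ends `P, P'`
and `Q, Q'` of two consecutive principal diagonals with weights `a` and `b` is proportional
to `a - b`. -/
theorem det2_half_area_defect (P P' Q Q' : ℝ × ℝ) (a b : ℝ)
    (h : det2 (Q - P) (P' - P) = det2 (Q' - P') (Q - Q')) :
    det2 (((1 - b) • Q + b • Q') - ((1 - a) • P + a • P'))
        (((1 - a) • P' + a • P) - ((1 - a) • P + a • P')) -
      det2 (((1 - b) • Q' + b • Q) - ((1 - a) • P' + a • P))
        (((1 - b) • Q + b • Q') - ((1 - b) • Q' + b • Q)) =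
      (a - b) * det2 (Q - P) (Q' - P') := by
  simp only [det2, Prod.fst_sub, Prod.snd_sub, Prod.fst_add, Prod.snd_add, Prod.smul_fst,
    Prod.smul_snd, smul_eq_mul] at h ⊢
  linear_combination (1 - a - b) * h

theorem inverse_construction_constant_weight
    (n : ℕ) (hn : 2 ≤ n) (γ : ℤ → ℝ × ℝ)
    (hper : ∀ i : ℤ, γ (i + 2 * n) = γ i)
    (v : ℤ → ℝ × ℝ) (hv : ∀ i, v i = γ (i + n) - γ i)
    (ap : ℤ → ℝ) (hap : ∀ i, ap i = det2 (γ (i + 1) - γ i) (v i))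
    (am : ℤ → ℝ) (ham : ∀ i, am i = det2 (γ (i + 1) - γ i) (v (i + 1)))
    (δ : ℤ → ℝ) (hδ : ∀ i, δ i = det2 (γ (i + 1) - γ i) (γ (i + n + 1) - γ (i + n)))
    (hha : ∀ i : ℤ, ap i = am (i + n))
    (hδnz : ∀ i : ℤ, δ i ≠ 0)
    (c : ℤ → ℝ) (hcper : ∀ i : ℤ, c (i + n) = c i)
    (γbar : ℤ → ℝ × ℝ) (hγbar : ∀ i, γbar i = (1 - c i) • γ i + c i • γ (i + n))
    (vbar : ℤ → ℝ × ℝ) (hvbar : ∀ i, vbar i = γbar (i + n) - γbar i)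
    (apbar : ℤ → ℝ) (hapbar : ∀ i, apbar i = det2 (γbar (i + 1) - γbar i) (vbar i))
    (ambar : ℤ → ℝ) (hambar : ∀ i, ambar i = det2 (γbar (i + 1) - γbar i) (vbar (i + 1))) :
    (∀ i : ℤ, apbar i = ambar (i + n)) ↔ (∀ i j : ℤ, c i = c j) := by
  have hγ (i : ℤ) : γ (i + n + n) = γ i := by
    rw [← hper i]; congr 1; ring
  have hγ' (i : ℤ) : γ (i + n + n + 1) = γ (i + 1) := by
    rw [← hper (i + 1)]; congr 1; ring
  have hcomm (i : ℤ) : i + 1 + n = i + n + 1 := by ring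
  have hc (i : ℤ) : c (i + n + 1) = c (i + 1) := by
    rw [← hcomm, hcper]
  have hdefect (i : ℤ) : apbar i - ambar (i + n) = (c i - c (i + 1)) * δ i := by
    have h := hha i
    simp only [hap, ham, hv, hcomm, hγ'] at h
    have key := det2_half_area_defect (γ i) (γ (i + n)) (γ (i + 1)) (γ (i + n + 1))
      (c i) (c (i + 1)) h
    simpa only [hapbar, hambar, hvbar, hγbar, hδ, hcper, hc, hγ, hγ', hcomm] using key
  have hstep (i : ℤ) : apbar i = ambar (i + n) ↔ c i = c (i + 1) := by
    rw [← sub_eq_zero, hdefect, mul_eq_zero, or_iff_left (hδnz i), sub_eq_zero]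
  refine ⟨fun h => ?_, fun h i => (hstep i).2 (h _ _)⟩
  have hone : Function.Periodic c 1 := fun i => ((hstep i).1 (h i)).symm
  have hzero (i : ℤ) : c i = c 0 := by
    simpa using hone.int_mul i 0
  exact fun i j => (hzero i).trans (hzero j).symm
end
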